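/- arXiv:0909.4577 — 4 statements merged into one kernel-verified Lean document; each statement's English description precedes it below -/
import Mathlib

section
/- Let n ∈ {6, 7} and let G be a bicyclic graph with n vertices that is not isomorphic to B_n(n−1,3). Then χ(G) ≥ 1/√(n+2) + 2/√n + (n−5)/√(n−1) + 2/√6 + 1/√5, with equality if and only if G is isomorphic to B_n(n−2,4). -/
open SimpleGraph

/-- The degree of a vertex (stated via `Set.ncard`, so no decidability assumptions). -/
noncomputable def degR {V : Type*} (G : SimpleGraph V) (v : V) : ℕ :=
  (G.neighborSet v).ncard

/-- The sum-connectivity index `χ(G) = ∑_{uv ∈ E(G)} 1/√(d_G(u)+d_G(v))`. -/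
noncomputable def sumConn {V : Type*} [Fintype V] (G : SimpleGraph V) : ℝ :=
  ∑ e ∈ G.edgeSet.toFinite.toFinset,
    Sym2.lift ⟨fun u v => (1 : ℝ) / Real.sqrt ((degR G u : ℝ) + (degR G v : ℝ)),
      fun u v => by simp [add_comm]⟩ e

/-- Vertex type of the graph `B_n(a,b)`. -/
def BabVert (a b : ℕ) : Type := Fin 4 ⊕ Fin (a - 3) ⊕ Fin (b - 3)

instance (a b : ℕ) : Fintype (BabVert a b) := by unfold BabVert; infer_instance

def BabRel (a b : ℕ) : BabVert a b → BabVert a b → Prop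
  | Sum.inl i, Sum.inl j =>
      (i = 0 ∧ j = 1) ∨ (i = 0 ∧ j = 2) ∨ (i = 0 ∧ j = 3) ∨ (i = 1 ∧ j = 2) ∨ (i = 1 ∧ j = 3)
  | Sum.inl i, Sum.inr (Sum.inl _) => i = 0
  | Sum.inl i, Sum.inr (Sum.inr _) => i = 1
  | _, _ => False

/-- The graph `B_n(a,b)` (where `a + b = n + 2`): the unique 4-vertex bicyclic graph
(`K₄` minus the edge between vertices `2` and `3`), with `a - 3` pendent vertices
attached to the degree-three vertex `0` and `b - 3` pendent vertices attached to
the degree-three vertex `1`. -/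
def BabGraph (a b : ℕ) : SimpleGraph (BabVert a b) := SimpleGraph.fromRel (BabRel a b)

theorem degR_iso {V W : Type*} {G : SimpleGraph V} {H : SimpleGraph W} (φ : G ≃g H) (v : V) :
    degR H (φ v) = degR G v :=
  (Set.ncard_congr' (φ.mapNeighborSet v)).symm

section sumConnBounds

variable {V : Type*} [Fintype V] (G : SimpleGraph V)

open scoped Classical in
theorem degR_eq_degree (v : V) : degR G v = G.degree v := by
  rw [degR, Set.ncard_eq_toFinset_card', ← SimpleGraph.card_neighborFinset_eq_degree]
  rfl

open scoped Classical in
theorem edgeSet_ncard_eq_card_edgeFinset : G.edgeSet.ncard = G.edgeFinset.card := by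
  rw [Set.ncard_eq_toFinset_card']
  rfl

/-- Summing vertex weights over both ends of every edge counts each weight `degR` times. -/
theorem sum_edges_add_eq_sum_degR_mul (h : V → ℝ) :
    ∑ e ∈ G.edgeSet.toFinite.toFinset,
      Sym2.lift ⟨fun u v => h u + h v, fun _ _ => add_comm _ _⟩ e =
      ∑ v, (degR G v : ℝ) * h v := by
  classical
  have key : ∀ e ∈ G.edgeSet.toFinite.toFinset,
      Sym2.lift ⟨fun u v => h u + h v, fun _ _ => add_comm _ _⟩ e =
        ∑ v, if v ∈ e then h v else 0 := by
    intro e he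
    induction e with
    | _ x y =>
      have hxy : x ≠ y := by
        have : G.Adj x y := by simpa using he
        exact this.ne
      rw [← Finset.sum_filter]
      have : (Finset.univ.filter fun v => v ∈ s(x, y)) = {x, y} := by
        ext v
        simp
      rw [this, Finset.sum_pair hxy]
      simp
  rw [Finset.sum_congr rfl key, Finset.sum_comm]
  refine Finset.sum_congr rfl fun v _ => ?_
  rw [← Finset.sum_filter, Finset.sum_const, nsmul_eq_mul, degR_eq_degree,
    ← SimpleGraph.card_incidenceFinset_eq_degree]
  congr 3
  ext e
  simp [SimpleGraph.incidenceSet]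

theorem sum_degR_mul_le_sumConn (h : V → ℝ)
    (hh : ∀ x y, G.Adj x y → h x + h y ≤ 1 / √((degR G x : ℝ) + (degR G y : ℝ))) :
    ∑ v, (degR G v : ℝ) * h v ≤ sumConn G := by
  rw [← sum_edges_add_eq_sum_degR_mul, sumConn]
  refine Finset.sum_le_sum fun e he => ?_
  induction e with
  | _ x y => simpa using hh x y (by simpa using he)

theorem sumConn_eq_sum_degR_mul (h : V → ℝ)
    (hh : ∀ x y, G.Adj x y → 1 / √((degR G x : ℝ) + (degR G y : ℝ)) = h x + h y) :
    sumConn G = ∑ v, (degR G v : ℝ) * h v := by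
  rw [← sum_edges_add_eq_sum_degR_mul, sumConn]
  refine Finset.sum_congr rfl fun e he => ?_
  induction e with
  | _ x y => simpa using hh x y (by simpa using he)

variable {G}

theorem sumConn_eq_of_iso {W : Type*} [Fintype W] {H : SimpleGraph W} (φ : G ≃g H) (h : W → ℝ)
    (hh : ∀ x y, H.Adj x y → 1 / √((degR H x : ℝ) + (degR H y : ℝ)) = h x + h y) :
    sumConn G = ∑ w, (degR H w : ℝ) * h w := by
  rw [sumConn_eq_sum_degR_mul G (fun v => h (φ v)), ← Equiv.sum_comp φ.toEquiv]
  · exact Finset.sum_congr rfl fun v _ => by rw [← degR_iso φ]; rfl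
  · intro x y hxy
    rw [← degR_iso φ x, ← degR_iso φ y]
    exact hh _ _ (φ.map_adj_iff.2 hxy)

theorem sum_degR_eq : ∑ v, degR G v = 2 * G.edgeSet.ncard := by
  classical
  simp_rw [degR_eq_degree, edgeSet_ncard_eq_card_edgeFinset]
  exact G.sum_degrees_eq_twice_card_edges

theorem degR_pos [Nontrivial V] (hconn : G.Connected) (v : V) : 1 ≤ degR G v := by
  classical
  rw [degR_eq_degree]
  exact hconn.preconnected.degree_pos_of_nontrivial v

theorem degR_lt_card (v : V) : degR G v < Fintype.card V := by
  classical
  rw [degR_eq_degree]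
  exact G.degree_lt_card_verts v

theorem degR_add_degR_le {u v : V} (huv : u ≠ v) :
    degR G u + degR G v ≤ G.edgeSet.ncard + 1 := by
  classical
  rw [degR_eq_degree, degR_eq_degree, edgeSet_ncard_eq_card_edgeFinset,
    ← G.card_incidenceFinset_eq_degree, ← G.card_incidenceFinset_eq_degree,
    ← Finset.card_union_add_card_inter]
  refine add_le_add (Finset.card_le_card (Finset.union_subset (G.incidenceFinset_subset u)
    (G.incidenceFinset_subset v))) ?_
  refine (Finset.card_le_card (t := {s(u, v)}) fun e he => ?_).trans_eq (Finset.card_singleton _)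
  rw [Finset.mem_singleton]
  refine G.incidenceSet_inter_incidenceSet_subset huv ?_
  simpa using he

/-- If the degrees of two distinct vertices are as large as the number of edges permits, these
vertices are adjacent and every edge meets one of them. -/
theorem adj_and_edges_meet_of_degR_add_degR_eq {u v : V} (huv : u ≠ v)
    (h : degR G u + degR G v = G.edgeSet.ncard + 1) :
    G.Adj u v ∧ ∀ x y, G.Adj x y → x = u ∨ x = v ∨ y = u ∨ y = v := by
  classical
  have hsub := Finset.union_subset (G.incidenceFinset_subset u) (G.incidenceFinset_subset v)
  have hle := Finset.card_le_card hsub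
  have hcard := Finset.card_union_add_card_inter (G.incidenceFinset u) (G.incidenceFinset v)
  rw [degR_eq_degree, degR_eq_degree, edgeSet_ncard_eq_card_edgeFinset,
    ← G.card_incidenceFinset_eq_degree, ← G.card_incidenceFinset_eq_degree] at h
  have hinter : (G.incidenceFinset u ∩ G.incidenceFinset v).card ≤ 1 := by
    refine (Finset.card_le_card (t := {s(u, v)}) fun e he => ?_).trans_eq
      (Finset.card_singleton _)
    rw [Finset.mem_singleton]
    refine G.incidenceSet_inter_incidenceSet_subset huv ?_
    simpa using he
  constructor
  · obtain ⟨e, he⟩ := Finset.card_pos.1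
      (show 0 < (G.incidenceFinset u ∩ G.incidenceFinset v).card by omega)
    simp only [Finset.mem_inter, SimpleGraph.mem_incidenceFinset] at he
    exact G.adj_of_mem_incidenceSet huv he.1 he.2
  · intro x y hxy
    have heq := Finset.eq_of_subset_of_card_le hsub (by omega)
    have : s(x, y) ∈ G.edgeFinset := by simpa using hxy
    rw [← heq] at this
    simp only [Finset.mem_union, SimpleGraph.mem_incidenceFinset,
      SimpleGraph.mk'_mem_incidenceSet_iff] at this
    grind

theorem nonempty_iso_babGraph_of_parametrization {a b : ℕ} {u v c d : V} (huv : G.Adj u v)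
    (hmeet : ∀ x y, G.Adj x y → x = u ∨ x = v ∨ y = u ∨ y = v)
    (hc : G.Adj u c ∧ G.Adj v c) (hd : G.Adj u d ∧ G.Adj v d) (hcd : c ≠ d)
    (p : Fin (a - 3) → V) (q : Fin (b - 3) → V)
    (hp : ∀ i, p i ≠ v ∧ G.Adj u (p i) ∧ ¬ G.Adj v (p i))
    (hq : ∀ i, q i ≠ u ∧ G.Adj v (q i) ∧ ¬ G.Adj u (q i))
    (hpi : Function.Injective p) (hqi : Function.Injective q)
    (hcard : 4 + ((a - 3) + (b - 3)) = Fintype.card V) :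
    Nonempty (G ≃g BabGraph a b) := by
  have hp' : ∀ i, p i ≠ u ∧ p i ≠ c ∧ p i ≠ d := fun i =>
    ⟨(hp i).2.1.ne', fun h => (hp i).2.2 (h ▸ hc.2), fun h => (hp i).2.2 (h ▸ hd.2)⟩
  have hq' : ∀ i, q i ≠ v ∧ q i ≠ c ∧ q i ≠ d := fun i =>
    ⟨(hq i).2.1.ne', fun h => (hq i).2.2 (h ▸ hc.1), fun h => (hq i).2.2 (h ▸ hd.1)⟩
  have hpq : ∀ i j, p i ≠ q j := fun i j h => (hp i).2.2 (h ▸ (hq j).2.1)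
  have hnone : ∀ x y, x ≠ u → x ≠ v → y ≠ u → y ≠ v → ¬ G.Adj x y := by
    intro x y h1 h2 h3 h4 hxy
    rcases hmeet x y hxy with h | h | h | h <;> contradiction
  have hcd' : ¬ G.Adj c d := hnone _ _ hc.1.ne' hc.2.ne' hd.1.ne' hd.2.ne'
  have hpp : ∀ i j, ¬ G.Adj (p i) (p j) := fun i j =>
    hnone _ _ (hp' i).1 (hp i).1 (hp' j).1 (hp j).1
  have hqq : ∀ i j, ¬ G.Adj (q i) (q j) := fun i j =>
    hnone _ _ (hq i).1 (hq' i).1 (hq j).1 (hq' j).1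
  have hpq' : ∀ i j, ¬ G.Adj (p i) (q j) := fun i j =>
    hnone _ _ (hp' i).1 (hp i).1 (hq j).1 (hq' j).1
  have hpc : ∀ i, ¬ G.Adj (p i) c := fun i => hnone _ _ (hp' i).1 (hp i).1 hc.1.ne' hc.2.ne'
  have hpd : ∀ i, ¬ G.Adj (p i) d := fun i => hnone _ _ (hp' i).1 (hp i).1 hd.1.ne' hd.2.ne'
  have hqc : ∀ i, ¬ G.Adj (q i) c := fun i => hnone _ _ (hq i).1 (hq' i).1 hc.1.ne' hc.2.ne'
  have hqd : ∀ i, ¬ G.Adj (q i) d := fun i => hnone _ _ (hq i).1 (hq' i).1 hd.1.ne' hd.2.ne'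
  let f : BabVert a b → V := Sum.elim ![u, v, c, d] (Sum.elim p q)
  have hfl : ∀ i : Fin 4, f (Sum.inl i) = ![u, v, c, d] i := fun _ => rfl
  have hfp : ∀ i, f (Sum.inr (Sum.inl i)) = p i := fun _ => rfl
  have hfq : ∀ i, f (Sum.inr (Sum.inr i)) = q i := fun _ => rfl
  have hinj : Function.Injective f := by
    refine Function.Injective.sumElim ?_ (hpi.sumElim hqi hpq) ?_
    · intro i j hij
      fin_cases i <;> fin_cases j <;>
        simp [huv.ne, huv.ne', hc.1.ne, hc.1.ne', hc.2.ne, hc.2.ne', hd.1.ne, hd.1.ne', hd.2.ne,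
          hd.2.ne', hcd, hcd.symm] at hij ⊢
    · rintro i (j | j)
      · fin_cases i
        exacts [(hp' j).1.symm, (hp j).1.symm, (hp' j).2.1.symm, (hp' j).2.2.symm]
      · fin_cases i
        exacts [(hq j).1.symm, (hq' j).1.symm, (hq' j).2.1.symm, (hq' j).2.2.symm]
  have hbij : Function.Bijective f := by
    refine (Fintype.bijective_iff_injective_and_card f).2 ⟨hinj, ?_⟩
    have : Fintype.card (BabVert a b) = Fintype.card (Fin 4 ⊕ Fin (a - 3) ⊕ Fin (b - 3)) := by
      congr!
    rw [this, ← hcard]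
    simp
  refine ⟨(RelIso.mk (Equiv.ofBijective f hbij) ?_ : BabGraph a b ≃g G).symm⟩
  intro x y
  change G.Adj (f x) (f y) ↔ x ≠ y ∧ (BabRel a b x y ∨ BabRel a b y x)
  rw [← hinj.ne_iff]
  rcases x with i | i | i <;> rcases y with j | j | j
  · fin_cases i <;> fin_cases j <;>
      simp [hfl, BabRel, huv, huv.symm, hc, hd, hc.1.symm, hc.2.symm, hd.1.symm, hd.2.symm,
        hcd', mt SimpleGraph.Adj.symm hcd', huv.ne, huv.ne', hc.1.ne, hc.1.ne', hc.2.ne,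
        hc.2.ne', hd.1.ne, hd.1.ne', hd.2.ne, hd.2.ne']
  · fin_cases i <;>
      simp [hfl, hfp, BabRel, hp j, (hp' j).1.symm, mt SimpleGraph.Adj.symm (hpc j),
        mt SimpleGraph.Adj.symm (hpd j)]
  · fin_cases i <;>
      simp [hfl, hfq, BabRel, hq j, (hq' j).1.symm, mt SimpleGraph.Adj.symm (hqc j),
        mt SimpleGraph.Adj.symm (hqd j)]
  · fin_cases j <;>
      simp [hfl, hfp, BabRel, hp i, hp' i, (hp i).2.1.symm, mt SimpleGraph.Adj.symm (hp i).2.2,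
        hpc, hpd]
  · simp [hfp, BabRel, hpp]
  · simp [hfp, hfq, BabRel, hpq']
  · fin_cases j <;>
      simp [hfl, hfq, BabRel, hq i, hq' i, (hq i).2.1.symm, mt SimpleGraph.Adj.symm (hq i).2.2,
        hqc, hqd]
  · simp [hfp, hfq, BabRel, mt SimpleGraph.Adj.symm (hpq' j i)]
  · simp [hfq, BabRel, hqq]

/-- A connected bicyclic graph in which two vertices have the maximal possible degree sum is
some `BabGraph a b`. -/
theorem nonempty_iso_babGraph [Nontrivial V] (hconn : G.Connected)
    (hedges : G.edgeSet.ncard = Fintype.card V + 1) {u v : V} (huv : u ≠ v)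
    (hu : 3 ≤ degR G u) (hv : 3 ≤ degR G v)
    (h : degR G u + degR G v = Fintype.card V + 2) :
    Nonempty (G ≃g BabGraph (degR G u) (degR G v)) := by
  classical
  obtain ⟨hadj, hmeet⟩ := adj_and_edges_meet_of_degR_add_degR_eq (G := G) huv (by omega)
  have hcover : ∀ w, w ≠ u → w ≠ v → G.Adj u w ∨ G.Adj v w := by
    intro w hwu hwv
    have hpos := degR_pos hconn w
    rw [degR_eq_degree] at hpos
    obtain ⟨x, hx⟩ := (G.degree_pos_iff_exists_adj w).1 hpos
    rcases hmeet w x hx with h | h | h | h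
    · exact absurd h hwu
    · exact absurd h hwv
    · exact Or.inl (h ▸ hx.symm)
    · exact Or.inr (h ▸ hx.symm)
  set C := G.neighborFinset u ∩ G.neighborFinset v with hC
  set P := (G.neighborFinset u \ G.neighborFinset v).erase v with hP
  set Q := (G.neighborFinset v \ G.neighborFinset u).erase u with hQ
  have cU : P.card + C.card + 1 = degR G u := by
    rw [hP, hC, Finset.card_erase_of_mem (by simp [hadj]), degR_eq_degree,
      ← G.card_neighborFinset_eq_degree]
    have := Finset.card_sdiff_add_card_inter (G.neighborFinset u) (G.neighborFinset v)
    have : 0 < (G.neighborFinset u \ G.neighborFinset v).card :=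
      Finset.card_pos.2 ⟨v, by simp [hadj]⟩
    omega
  have cV : Q.card + C.card + 1 = degR G v := by
    rw [hQ, hC, Finset.card_erase_of_mem (by simp [hadj.symm]), degR_eq_degree,
      ← G.card_neighborFinset_eq_degree, Finset.inter_comm]
    have := Finset.card_sdiff_add_card_inter (G.neighborFinset v) (G.neighborFinset u)
    have : 0 < (G.neighborFinset v \ G.neighborFinset u).card :=
      Finset.card_pos.2 ⟨u, by simp [hadj.symm]⟩
    omega
  have cUnion : (G.neighborFinset u ∪ G.neighborFinset v).card = Fintype.card V := by
    rw [← Finset.card_univ]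
    congr 1
    ext w
    simp only [Finset.mem_union, SimpleGraph.mem_neighborFinset, Finset.mem_univ, iff_true]
    rcases eq_or_ne w u with rfl | hwu
    · exact Or.inr hadj.symm
    rcases eq_or_ne w v with rfl | hwv
    · exact Or.inl hadj
    exact hcover w hwu hwv
  have cC : C.card = 2 := by
    have := Finset.card_union_add_card_inter (G.neighborFinset u) (G.neighborFinset v)
    rw [G.card_neighborFinset_eq_degree, G.card_neighborFinset_eq_degree, ← degR_eq_degree,
      ← degR_eq_degree, cUnion, ← hC] at this
    omega
  obtain ⟨c, d, hcd, hCcd⟩ := Finset.card_eq_two.1 cC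
  have hmC : ∀ w, w ∈ C ↔ G.Adj u w ∧ G.Adj v w := by simp [hC]
  have hmP : ∀ w, w ∈ P ↔ w ≠ v ∧ G.Adj u w ∧ ¬ G.Adj v w := by simp [hP]
  have hmQ : ∀ w, w ∈ Q ↔ w ≠ u ∧ G.Adj v w ∧ ¬ G.Adj u w := by simp [hQ]
  have hc := (hmC c).1 (by simp [hCcd])
  have hd := (hmC d).1 (by simp [hCcd])
  let eP : Fin (degR G u - 3) ≃ P := (P.equivFinOfCardEq (by omega)).symm
  let eQ : Fin (degR G v - 3) ≃ Q := (Q.equivFinOfCardEq (by omega)).symm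
  have hePm : ∀ i, (eP i : V) ≠ v ∧ G.Adj u (eP i) ∧ ¬ G.Adj v (eP i) :=
    fun i => (hmP _).1 (eP i).2
  have heQm : ∀ i, (eQ i : V) ≠ u ∧ G.Adj v (eQ i) ∧ ¬ G.Adj u (eQ i) :=
    fun i => (hmQ _).1 (eQ i).2
  have hePi : ∀ i j, (eP i : V) = eP j → i = j := fun i j h => eP.injective (Subtype.ext h)
  have heQi : ∀ i j, (eQ i : V) = eQ j → i = j := fun i j h => eQ.injective (Subtype.ext h)
  exact nonempty_iso_babGraph_of_parametrization hadj hmeet hc hd hcd (fun i => (eP i : V))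
    (fun i => (eQ i : V)) hePm heQm hePi heQi (by omega)

end sumConnBounds

section numericalBounds

theorem le_one_div_sqrt {c s : ℝ} (hs : 0 < s) (h : c ^ 2 * s ≤ 1) : c ≤ 1 / √s := by
  rw [le_div_iff₀ (Real.sqrt_pos.2 hs)]
  refine le_of_abs_le (abs_le_of_sq_le_sq ?_ zero_le_one)
  rwa [mul_pow, Real.sq_sqrt hs.le, one_pow]

theorem one_div_sqrt_le {c s : ℝ} (hc : 0 ≤ c) (hs : 0 < s) (h : 1 ≤ c ^ 2 * s) :
    1 / √s ≤ c := by
  rw [div_le_iff₀ (Real.sqrt_pos.2 hs)]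
  refine le_of_abs_le (abs_le_of_sq_le_sq ?_ (by positivity))
  rwa [mul_pow, Real.sq_sqrt hs.le, one_pow]

variable {V : Type*} [Fintype V] {G : SimpleGraph V}

/-- A lower bound for `sumConn` from vertex weights `A / d + B` depending on the degree `d`. -/
theorem card_mul_add_le_sumConn {E : ℕ} {A B : ℝ} (hpos : ∀ v, 1 ≤ degR G v)
    (hE : ∀ v, degR G v ≤ E)
    (hQ : ∀ d ∈ Finset.Icc 1 E, ∀ e ∈ Finset.Icc 1 E,
      ((A / d + B) + (A / e + B)) ^ 2 * ((d : ℝ) + e) ≤ 1) :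
    Fintype.card V * A + 2 * G.edgeSet.ncard * B ≤ sumConn G := by
  refine le_trans (le_of_eq ?_) (sum_degR_mul_le_sumConn G (fun v => A / degR G v + B) ?_)
  · have hsum : ∑ v, (degR G v : ℝ) = 2 * G.edgeSet.ncard := mod_cast sum_degR_eq (G := G)
    have : ∀ v, (degR G v : ℝ) * (A / degR G v + B) = A + degR G v * B := by
      intro v
      have : (degR G v : ℝ) ≠ 0 := by have := hpos v; positivity
      field_simp
    simp_rw [this, Finset.sum_add_distrib, ← Finset.sum_mul, hsum]
    simp
  · intro x y _
    have hx := hpos x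
    exact le_one_div_sqrt (by positivity) (hQ _ (Finset.mem_Icc.2 ⟨hx, hE x⟩) _
      (Finset.mem_Icc.2 ⟨hpos y, hE y⟩))

/-- A lower bound for `sumConn` from vertex weights `A / d + B` depending on the degree `d`,
except that the vertex `u` has weight `P`. -/
theorem degR_mul_add_le_sumConn (u : V) {D E : ℕ} {P A B : ℝ} (hpos : ∀ v, 1 ≤ degR G v)
    (hD : degR G u = D) (hE : ∀ v, v ≠ u → degR G v ≤ E)
    (hP : ∀ d ∈ Finset.Icc 1 E, (P + (A / d + B)) ^ 2 * ((D : ℝ) + d) ≤ 1)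
    (hQ : ∀ d ∈ Finset.Icc 1 E, ∀ e ∈ Finset.Icc 1 E,
      ((A / d + B) + (A / e + B)) ^ 2 * ((d : ℝ) + e) ≤ 1) :
    D * P + (Fintype.card V - 1) * A + (2 * G.edgeSet.ncard - D) * B ≤ sumConn G := by
  classical
  refine le_trans (le_of_eq ?_) (sum_degR_mul_le_sumConn G
    (fun v => if v = u then P else A / degR G v + B) ?_)
  · have hsum : ∑ v, (degR G v : ℝ) = 2 * G.edgeSet.ncard := mod_cast sum_degR_eq (G := G)
    have : ∀ v, (degR G v : ℝ) * (if v = u then P else A / degR G v + B) =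
        A + degR G v * B + if v = u then D * P - A - D * B else 0 := by
      intro v
      have : (degR G v : ℝ) ≠ 0 := by have := hpos v; positivity
      split_ifs with h
      · rw [h, hD]; ring
      · field_simp
        ring
    simp_rw [this, Finset.sum_add_distrib, ← Finset.sum_mul, hsum]
    simp
    ring
  · intro x y hxy
    have hx := hpos x
    refine le_one_div_sqrt (by positivity) ?_
    rcases eq_or_ne x u with rfl | hxu
    · rw [if_pos rfl, if_neg hxy.ne', hD]
      exact hP _ (Finset.mem_Icc.2 ⟨hpos y, hE y hxy.ne'⟩)
    rcases eq_or_ne y u with rfl | hyu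
    · rw [if_pos rfl, if_neg hxu, hD, add_comm _ P, add_comm _ (D : ℝ)]
      exact hP _ (Finset.mem_Icc.2 ⟨hx, hE x hxu⟩)
    rw [if_neg hxu, if_neg hyu]
    exact hQ _ (Finset.mem_Icc.2 ⟨hx, hE x hxu⟩) _ (Finset.mem_Icc.2 ⟨hpos y, hE y hyu⟩)

end numericalBounds

section extremalValue

instance (a b : ℕ) : DecidableEq (BabVert a b) := by unfold BabVert; infer_instance

instance (a b : ℕ) : ∀ x y, Decidable (BabRel a b x y)
  | Sum.inl _, Sum.inl _ => by unfold BabRel; infer_instance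
  | Sum.inl _, Sum.inr (Sum.inl _) => by unfold BabRel; infer_instance
  | Sum.inl _, Sum.inr (Sum.inr _) => by unfold BabRel; infer_instance
  | Sum.inr _, _ => by unfold BabRel; infer_instance

instance (a b : ℕ) : DecidableRel (BabGraph a b).Adj := fun x y =>
  inferInstanceAs (Decidable (x ≠ y ∧ (BabRel a b x y ∨ BabRel a b y x)))

theorem degR_eq_card_filter {W : Type*} [Fintype W] (H : SimpleGraph W) [DecidableRel H.Adj]
    (w : W) : degR H w = (Finset.univ.filter (H.Adj w)).card := by
  rw [degR, ← Set.ncard_coe_finset]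
  congr
  ext
  simp

/-- The function on `BabVert a b` with value `x`, `y` at the vertices of degree `a`, `b`, value `z`
at their two common neighbours, and value `p`, `q` at the pendent vertices. -/
def babFun (a b : ℕ) {α : Type*} (x y z p q : α) : BabVert a b → α
  | Sum.inl i => ![x, y, z, z] i
  | Sum.inr (Sum.inl _) => p
  | Sum.inr (Sum.inr _) => q

theorem degR_babGraph_four_four (w : BabVert 4 4) :
    degR (BabGraph 4 4) w = babFun 4 4 4 4 2 1 1 w := by
  rw [degR_eq_card_filter]
  revert w
  decide

theorem degR_babGraph_five_four (w : BabVert 5 4) :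
    degR (BabGraph 5 4) w = babFun 5 4 5 4 2 1 1 w := by
  rw [degR_eq_card_filter]
  revert w
  decide

variable {V : Type*} [Fintype V] {G : SimpleGraph V}

theorem sumConn_of_iso_babGraph {a b : ℕ} (ha : 3 ≤ a) (hb : 3 ≤ b)
    (hdeg : ∀ w, degR (BabGraph a b) w = babFun a b a b 2 1 1 w) (φ : G ≃g BabGraph a b) :
    sumConn G = 1 / √((a : ℝ) + b) + 2 / √((a : ℝ) + 2) + 2 / √((b : ℝ) + 2) +
      ((a : ℝ) - 3) / √((a : ℝ) + 1) + ((b : ℝ) - 3) / √((b : ℝ) + 1) := by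
  obtain ⟨k, hk⟩ : ∃ k, k = (1 / √((a : ℝ) + 2) + 1 / √((b : ℝ) + 2) - 1 / √((a : ℝ) + b)) / 2 :=
    ⟨_, rfl⟩
  rw [sumConn_eq_of_iso φ (babFun a b (1 / √((a : ℝ) + 2) - k) (1 / √((b : ℝ) + 2) - k) k
    (1 / √((a : ℝ) + 1) - (1 / √((a : ℝ) + 2) - k))
    (1 / √((b : ℝ) + 1) - (1 / √((b : ℝ) + 2) - k)))]
  · simp_rw [hdeg]
    change ∑ w : Fin 4 ⊕ Fin (a - 3) ⊕ Fin (b - 3), _ = _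
    rw [Fintype.sum_sum_type, Fintype.sum_sum_type]
    simp [Fin.sum_univ_four, babFun, ha, hb]
    rw [hk]
    ring
  · simp_rw [hdeg]
    rintro x y ⟨-, h⟩
    wlog hrel : BabRel a b x y generalizing x y
    · rw [add_comm, add_comm (babFun _ _ _ _ _ _ _ x)]
      exact this y x h.symm (h.resolve_left hrel)
    rcases x with i | i | i
    · rcases y with j | j | j
      · simp only [BabRel] at hrel
        rcases hrel with ⟨rfl, rfl⟩ | ⟨rfl, rfl⟩ | ⟨rfl, rfl⟩ | ⟨rfl, rfl⟩ | ⟨rfl, rfl⟩ <;>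
          simp [babFun, hk] <;> ring
      · obtain rfl : i = 0 := hrel
        simp [babFun]
      · obtain rfl : i = 1 := hrel
        simp [babFun]
    all_goals exact hrel.elim

end extremalValue

section smallOrder

variable {V : Type*} [Fintype V] {G : SimpleGraph V}

/-- A bicyclic graph that is neither `B₆(5, 3)` nor `B₆(4, 4)` exceeds the index of the latter. -/
theorem lt_sumConn_of_card_eq_six (hconn : G.Connected) (hcard : Fintype.card V = 6)
    (hedges : G.edgeSet.ncard = 7) (h53 : ¬ Nonempty (G ≃g BabGraph 5 3))
    (h44 : ¬ Nonempty (G ≃g BabGraph 4 4)) :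
    1 / √8 + 4 / √6 + 2 / √5 < sumConn G := by
  have : Nontrivial V := Fintype.one_lt_card_iff_nontrivial.1 (by omega)
  have hpos := degR_pos hconn
  have htarget : 1 / √8 + 4 / √6 + 2 / √5 < (2.883 : ℝ) := by
    have h8 : 1 / √8 ≤ (0.3536 : ℝ) := one_div_sqrt_le (by norm_num) (by norm_num) (by norm_num)
    have h6 : 1 / √6 ≤ (0.4083 : ℝ) := one_div_sqrt_le (by norm_num) (by norm_num) (by norm_num)
    have h5 : 1 / √5 ≤ (0.4473 : ℝ) := one_div_sqrt_le (by norm_num) (by norm_num) (by norm_num)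
    linear_combination h8 + 4 * h6 + 2 * h5
  refine htarget.trans ?_
  obtain ⟨u, hu⟩ := Finite.exists_max (degR G)
  have hlt := degR_lt_card (G := G) u
  have hpair : ∀ v, v ≠ u → degR G u + degR G v ≤ 8 := fun v hv => by
    have := degR_add_degR_le (G := G) hv.symm
    omega
  have hiso : ∀ v, v ≠ u → ∀ a b, degR G u = a → degR G v = b → 3 ≤ a → 3 ≤ b → a + b = 8 →
      Nonempty (G ≃g BabGraph a b) := by
    rintro v hv a b rfl rfl ha hb hab
    exact nonempty_iso_babGraph hconn (by omega) hv.symm ha hb (by omega)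
  obtain h | h | h : degR G u = 5 ∨ degR G u = 4 ∨ degR G u ≤ 3 := by omega
  · have hE : ∀ v, v ≠ u → degR G v ≤ 2 := fun v hv => by
      have := hpair v hv
      by_contra hcon
      exact h53 (hiso v hv 5 3 h (by omega) (by norm_num) (by norm_num) (by norm_num))
    refine lt_of_lt_of_le ?_ (degR_mul_add_le_sumConn u (P := 0.1279) (A := 0.06) (B := 0.22)
      hpos h hE ?_ ?_)
    · rw [hcard, hedges]
      norm_num
    · intro d hd
      fin_cases hd <;> norm_num
    · intro d hd e he
      fin_cases hd <;> fin_cases he <;> norm_num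
  · have hE : ∀ v, v ≠ u → degR G v ≤ 3 := fun v hv => by
      have := hpair v hv
      by_contra hcon
      exact h44 (hiso v hv 4 4 h (by omega) (by norm_num) (by norm_num) (by norm_num))
    refine lt_of_lt_of_le ?_ (degR_mul_add_le_sumConn u (P := 0.163) (A := 0.12) (B := 0.164)
      hpos h hE ?_ ?_)
    · rw [hcard, hedges]
      norm_num
    · intro d hd
      fin_cases hd <;> norm_num
    · intro d hd e he
      fin_cases hd <;> fin_cases he <;> norm_num
  · refine lt_of_lt_of_le ?_ (card_mul_add_le_sumConn (A := 0.12) (B := 0.164) hpos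
      (fun v => (hu v).trans h) ?_)
    · rw [hcard, hedges]
      norm_num
    · intro d hd e he
      fin_cases hd <;> fin_cases he <;> norm_num

/-- A bicyclic graph that is neither `B₇(6, 3)` nor `B₇(5, 4)` exceeds the index of the latter. -/
theorem lt_sumConn_of_card_eq_seven (hconn : G.Connected) (hcard : Fintype.card V = 7)
    (hedges : G.edgeSet.ncard = 8) (h63 : ¬ Nonempty (G ≃g BabGraph 6 3))
    (h54 : ¬ Nonempty (G ≃g BabGraph 5 4)) :
    1 / √9 + 2 / √7 + 4 / √6 + 1 / √5 < sumConn G := by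
  have : Nontrivial V := Fintype.one_lt_card_iff_nontrivial.1 (by omega)
  have hpos := degR_pos hconn
  have htarget : 1 / √9 + 2 / √7 + 4 / √6 + 1 / √5 < (3.1696 : ℝ) := by
    have h9 : 1 / √9 ≤ (0.33334 : ℝ) := one_div_sqrt_le (by norm_num) (by norm_num) (by norm_num)
    have h7 : 1 / √7 ≤ (0.37797 : ℝ) := one_div_sqrt_le (by norm_num) (by norm_num) (by norm_num)
    have h6 : 1 / √6 ≤ (0.40825 : ℝ) := one_div_sqrt_le (by norm_num) (by norm_num) (by norm_num)
    have h5 : 1 / √5 ≤ (0.44722 : ℝ) := one_div_sqrt_le (by norm_num) (by norm_num) (by norm_num)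
    linear_combination h9 + 2 * h7 + 4 * h6 + h5
  refine htarget.trans ?_
  obtain ⟨u, hu⟩ := Finite.exists_max (degR G)
  have hlt := degR_lt_card (G := G) u
  have hpair : ∀ v, v ≠ u → degR G u + degR G v ≤ 9 := fun v hv => by
    have := degR_add_degR_le (G := G) hv.symm
    omega
  have hiso : ∀ v, v ≠ u → ∀ a b, degR G u = a → degR G v = b → 3 ≤ a → 3 ≤ b → a + b = 9 →
      Nonempty (G ≃g BabGraph a b) := by
    rintro v hv a b rfl rfl ha hb hab
    exact nonempty_iso_babGraph hconn (by omega) hv.symm ha hb (by omega)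
  obtain h | h | h : degR G u = 6 ∨ degR G u = 5 ∨ degR G u ≤ 4 := by omega
  · have hE : ∀ v, v ≠ u → degR G v ≤ 2 := fun v hv => by
      have := hpair v hv
      by_contra hcon
      exact h63 (hiso v hv 6 3 h (by omega) (by norm_num) (by norm_num) (by norm_num))
    refine lt_of_lt_of_le ?_ (degR_mul_add_le_sumConn u (P := 0.1035) (A := 0.0488) (B := 0.2256)
      hpos h hE ?_ ?_)
    · rw [hcard, hedges]
      norm_num
    · intro d hd
      fin_cases hd <;> norm_num
    · intro d hd e he
      fin_cases hd <;> fin_cases he <;> norm_num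
  · have hE : ∀ v, v ≠ u → degR G v ≤ 3 := fun v hv => by
      have := hpair v hv
      by_contra hcon
      exact h54 (hiso v hv 5 4 h (by omega) (by norm_num) (by norm_num) (by norm_num))
    refine lt_of_lt_of_le ?_ (degR_mul_add_le_sumConn u (P := 0.144) (A := 0.09) (B := 0.174)
      hpos h hE ?_ ?_)
    · rw [hcard, hedges]
      norm_num
    · intro d hd
      fin_cases hd <;> norm_num
    · intro d hd e he
      fin_cases hd <;> fin_cases he <;> norm_num
  · refine lt_of_lt_of_le ?_ (card_mul_add_le_sumConn (A := 0.124) (B := 0.1455) hpos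
      (fun v => (hu v).trans h) ?_)
    · rw [hcard, hedges]
      norm_num
    · intro d hd e he
      fin_cases hd <;> fin_cases he <;> norm_num

end smallOrder

/-- Let `n ∈ {6, 7}` and let `G` be a bicyclic graph with `n` vertices that is not
isomorphic to `B_n(n−1, 3)`. Then
`χ(G) ≥ 1/√(n+2) + 2/√n + (n−5)/√(n−1) + 2/√6 + 1/√5`, with equality if and only if
`G ≅ B_n(n−2, 4)`. -/
theorem stmt_12 {V : Type*} [Fintype V] (G : SimpleGraph V) (n : ℕ)
    (hn : n = 6 ∨ n = 7)
    (hcard : Fintype.card V = n) (hconn : G.Connected)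
    (hedges : G.edgeSet.ncard = n + 1)
    (hnot : ¬ Nonempty (G ≃g BabGraph (n - 1) 3)) :
    sumConn G ≥ 1 / Real.sqrt ((n : ℝ) + 2) + 2 / Real.sqrt (n : ℝ) +
        ((n : ℝ) - 5) / Real.sqrt ((n : ℝ) - 1) + 2 / Real.sqrt 6 + 1 / Real.sqrt 5 ∧
    (sumConn G = 1 / Real.sqrt ((n : ℝ) + 2) + 2 / Real.sqrt (n : ℝ) +
        ((n : ℝ) - 5) / Real.sqrt ((n : ℝ) - 1) + 2 / Real.sqrt 6 + 1 / Real.sqrt 5 ↔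
      Nonempty (G ≃g BabGraph (n - 2) 4)) := by
  rcases hn with rfl | rfl
  · have htarget : 1 / √(((6 : ℕ) : ℝ) + 2) + 2 / √((6 : ℕ) : ℝ) +
        (((6 : ℕ) : ℝ) - 5) / √(((6 : ℕ) : ℝ) - 1) + 2 / √6 + 1 / √5 =
        1 / √8 + 4 / √6 + 2 / √5 := by
      norm_num
      ring
    rw [htarget]
    by_cases h : Nonempty (G ≃g BabGraph (6 - 2) 4)
    · obtain ⟨φ⟩ := h
      have heq : sumConn G = 1 / √8 + 4 / √6 + 2 / √5 := by
        rw [sumConn_of_iso_babGraph (by norm_num) (by norm_num) degR_babGraph_four_four φ]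
        norm_num
        ring
      exact ⟨heq.ge, fun _ => ⟨φ⟩, fun _ => heq⟩
    · have hlt := lt_sumConn_of_card_eq_six hconn hcard hedges hnot h
      exact ⟨hlt.le, fun heq => absurd heq hlt.ne', fun hiso => absurd hiso h⟩
  · have htarget : 1 / √(((7 : ℕ) : ℝ) + 2) + 2 / √((7 : ℕ) : ℝ) +
        (((7 : ℕ) : ℝ) - 5) / √(((7 : ℕ) : ℝ) - 1) + 2 / √6 + 1 / √5 =
        1 / √9 + 2 / √7 + 4 / √6 + 1 / √5 := by
      norm_num
      ring
    rw [htarget]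
    by_cases h : Nonempty (G ≃g BabGraph (7 - 2) 4)
    · obtain ⟨φ⟩ := h
      have heq : sumConn G = 1 / √9 + 2 / √7 + 4 / √6 + 1 / √5 := by
        rw [sumConn_of_iso_babGraph (by norm_num) (by norm_num) degR_babGraph_five_four φ]
        norm_num
        ring
      exact ⟨heq.ge, fun _ => ⟨φ⟩, fun _ => heq⟩
    · have hlt := lt_sumConn_of_card_eq_seven hconn hcard hedges hnot h
      exact ⟨hlt.le, fun heq => absurd heq hlt.ne', fun hiso => absurd hiso h⟩
end

section
/- Let M be a connected finite simple graph with a vertex u of degree 2 in M whose maximum degree is at most five, let H be the graph obtained from M by attaching a path P_a (a ≥ 1, on a new vertices) to u, let u₁, u₂ be the two neighbors of u in M, and let u′ be the pendent end-vertex of the attached path (u′ = the unique pendent vertex of the path attached to u; if a = 1, u′ is the attached vertex itself). Let H′ = H − uu₂ + u′u₂ (delete the edge uu₂ and add the edge u′u₂). Then χ(H′) > χ(H). -/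
open SimpleGraph

/-- The graph obtained from `M` by attaching a path `P_a` on `a` new vertices to `u`:
the path vertex `Sum.inr ⟨0,_⟩` is joined to `u` by an edge, the path consists of the
edges between consecutive new vertices, and `Sum.inr ⟨a-1,_⟩` is the pendent
end-vertex of the attached path. -/
def attachPath {W : Type*} (M : SimpleGraph W) (u : W) (a : ℕ) :
    SimpleGraph (W ⊕ Fin a) :=
  SimpleGraph.fromRel (fun x y =>
    (∃ w w', x = Sum.inl w ∧ y = Sum.inl w' ∧ M.Adj w w') ∨
    (∃ h : 0 < a, x = Sum.inl u ∧ y = Sum.inr ⟨0, h⟩) ∨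
    (∃ i j : Fin a, x = Sum.inr i ∧ y = Sum.inr j ∧ (j : ℕ) = (i : ℕ) + 1))

namespace PathRerouting

section AttachPath

variable {W : Type*} {M : SimpleGraph W} {u : W} {a : ℕ}

@[simp]
lemma attachPath_adj_inl_inl {v w : W} :
    (attachPath M u a).Adj (Sum.inl v) (Sum.inl w) ↔ M.Adj v w := by
  simp only [attachPath, fromRel_adj]
  constructor
  · rintro ⟨-, h⟩
    simpa [M.adj_comm w v] using h
  · intro h
    exact ⟨by simpa using h.ne, Or.inl (Or.inl ⟨v, w, rfl, rfl, h⟩)⟩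

@[simp]
lemma attachPath_adj_inl_inr {v : W} {i : Fin a} :
    (attachPath M u a).Adj (Sum.inl v) (Sum.inr i) ↔ v = u ∧ (i : ℕ) = 0 := by
  have := i.pos
  simp [attachPath, Fin.ext_iff, this]

@[simp]
lemma attachPath_adj_inr_inl {v : W} {i : Fin a} :
    (attachPath M u a).Adj (Sum.inr i) (Sum.inl v) ↔ v = u ∧ (i : ℕ) = 0 := by
  rw [adj_comm, attachPath_adj_inl_inr]

@[simp]
lemma attachPath_adj_inr_inr {i j : Fin a} :
    (attachPath M u a).Adj (Sum.inr i) (Sum.inr j) ↔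
      (j : ℕ) = i + 1 ∨ (i : ℕ) = j + 1 := by
  have h : ∀ i j : Fin a, (∃ i' j' : Fin a, (Sum.inr i : W ⊕ Fin a) = Sum.inr i' ∧
      (Sum.inr j : W ⊕ Fin a) = Sum.inr j' ∧ (j' : ℕ) = i' + 1) ↔ (j : ℕ) = i + 1 := by
    simp
  simp only [attachPath, fromRel_adj, h]
  simp only [ne_eq, Sum.inr.injEq, Fin.ext_iff, reduceCtorEq, false_and, exists_false, false_or]
  omega

lemma degR_attachPath_inl {w : W} (hw : w ≠ u) :
    degR (attachPath M u a) (Sum.inl w) = degR M w := by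
  have : (attachPath M u a).neighborSet (Sum.inl w) = Sum.inl '' M.neighborSet w := by
    ext (x | x) <;> simp [hw]
  rw [degR, this, Set.ncard_image_of_injective _ Sum.inl_injective, degR]

lemma degR_attachPath_last (ha : a - 1 < a) :
    degR (attachPath M u a) (Sum.inr ⟨a - 1, ha⟩) = 1 := by
  rw [degR, Set.ncard_eq_one]
  rcases Nat.lt_or_ge 1 a with h | h
  · refine ⟨Sum.inr ⟨a - 2, by omega⟩, ?_⟩
    ext (x | x)
    · simp; omega
    · simp [Fin.ext_iff]; omega
  · refine ⟨Sum.inl u, ?_⟩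
    ext (x | x)
    · simp; omega
    · simp; omega

lemma degR_attachPath_inr {i : ℕ} (hi : i < a) (hia : i + 1 < a) :
    degR (attachPath M u a) (Sum.inr ⟨i, hi⟩) = 2 := by
  rw [degR, Set.ncard_eq_two]
  rcases i with _ | i
  · refine ⟨Sum.inl u, Sum.inr ⟨1, hia⟩, by simp, ?_⟩
    ext (x | x) <;> simp [Fin.ext_iff]
  · refine ⟨Sum.inr ⟨i, by omega⟩, Sum.inr ⟨i + 2, hia⟩, by simp, ?_⟩
    ext (x | x)
    · simp
    · simp [Fin.ext_iff]; omega

end AttachPath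

lemma adj_iff_of_degR_eq_two {W : Type*} [Finite W] {M : SimpleGraph W} {u u₁ u₂ : W}
    (h1 : M.Adj u u₁) (h2 : M.Adj u u₂) (h12 : u₁ ≠ u₂) (hdeg : degR M u = 2) (w : W) :
    M.Adj u w ↔ w = u₁ ∨ w = u₂ := by
  have h : ({u₁, u₂} : Set W) = M.neighborSet u := by
    refine Set.eq_of_subset_of_ncard_le ?_ ?_
    · rintro x (rfl | rfl) <;> assumption
    · rw [Set.ncard_pair h12]; exact hdeg.le
  have := Set.ext_iff.1 h w
  simpa using this.symm

/-- The summand of `sumConn` at an edge. -/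
noncomputable def edgeWeight {V : Type*} (G : SimpleGraph V) (e : Sym2 V) : ℝ :=
  Sym2.lift ⟨fun u v => (1 : ℝ) / Real.sqrt ((degR G u : ℝ) + (degR G v : ℝ)),
    fun u v => by simp [add_comm]⟩ e

@[simp]
lemma edgeWeight_mk {V : Type*} (G : SimpleGraph V) (x y : V) :
    edgeWeight G s(x, y) = 1 / Real.sqrt ((degR G x : ℝ) + (degR G y : ℝ)) := rfl

/-- The graph `H - vw + xw`. -/
def moveEdge {V : Type*} (H : SimpleGraph V) (v w x : V) : SimpleGraph V :=
  H.deleteEdges {s(v, w)} ⊔ fromEdgeSet {s(x, w)}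

section MoveEdge

variable {V : Type*} {H : SimpleGraph V} {v w x : V}

lemma sumConn_moveEdge_sub [Fintype V] (hvw : H.Adj v w) (hxw : ¬ H.Adj x w) (hne : x ≠ w) :
    sumConn (moveEdge H v w x) - sumConn H =
      edgeWeight (moveEdge H v w x) s(x, w) - edgeWeight H s(v, w) +
      ∑ e ∈ (H.deleteEdges {s(v, w)}).edgeSet.toFinite.toFinset,
        (edgeWeight (moveEdge H v w x) e - edgeWeight H e) := by
  classical
  have hH : H.edgeSet.toFinite.toFinset =
      insert s(v, w) (H.deleteEdges {s(v, w)}).edgeSet.toFinite.toFinset := by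
    ext e
    simp only [Set.Finite.mem_toFinset, Finset.mem_insert, edgeSet_deleteEdges, Set.mem_sdiff,
      Set.mem_singleton_iff]
    constructor
    · tauto
    · rintro (rfl | h)
      · exact hvw
      · exact h.1
  have hH' : (moveEdge H v w x).edgeSet.toFinite.toFinset =
      insert s(x, w) (H.deleteEdges {s(v, w)}).edgeSet.toFinite.toFinset := by
    ext e
    simp only [Set.Finite.mem_toFinset, Finset.mem_insert, moveEdge, edgeSet_sup,
      edgeSet_fromEdgeSet, Set.mem_union, Set.mem_sdiff, Set.mem_singleton_iff]
    constructor
    · tauto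
    · rintro (rfl | h)
      · exact Or.inr ⟨rfl, by simpa using hne⟩
      · exact Or.inl h
  have e1 : sumConn H = ∑ e ∈ H.edgeSet.toFinite.toFinset, edgeWeight H e := rfl
  have e2 : sumConn (moveEdge H v w x) =
    ∑ e ∈ (moveEdge H v w x).edgeSet.toFinite.toFinset,
      edgeWeight (moveEdge H v w x) e := rfl
  rw [e1, e2, hH, hH', Finset.sum_insert, Finset.sum_insert, Finset.sum_sub_distrib]
  · ring
  · simp
  · simp [hxw]

lemma moveEdge_adj (hne : x ≠ w) {y z : V} : (moveEdge H v w x).Adj y z ↔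
    (H.Adj y z ∧ s(y, z) ≠ s(v, w)) ∨ s(y, z) = s(x, w) := by
  simp only [moveEdge, sup_adj, deleteEdges_adj, fromEdgeSet_adj, Set.mem_singleton_iff, ne_eq]
  refine or_congr_right ⟨And.left, fun h => ⟨h, ?_⟩⟩
  rintro rfl
  simp only [Sym2.eq_iff] at h
  grind

lemma degR_moveEdge_old [Finite V] (hvw : H.Adj v w) (hvx : v ≠ x) (hne : x ≠ w) :
    degR (moveEdge H v w x) v + 1 = degR H v := by
  have h : (moveEdge H v w x).neighborSet v = H.neighborSet v \ {w} := by
    ext z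
    have := hvw.ne
    simp only [mem_neighborSet, moveEdge_adj hne, Set.mem_sdiff, Set.mem_singleton_iff,
      Sym2.eq_iff, ne_eq]
    grind
  rw [degR, h]
  exact Set.ncard_sdiff_singleton_add_one hvw

lemma degR_moveEdge_new [Finite V] (hxw : ¬ H.Adj x w) (hvx : v ≠ x) (hne : x ≠ w) :
    degR (moveEdge H v w x) x = degR H x + 1 := by
  have h : (moveEdge H v w x).neighborSet x = insert w (H.neighborSet x) := by
    ext z
    simp only [mem_neighborSet, moveEdge_adj hne, Set.mem_insert_iff,
      Sym2.eq_iff, ne_eq]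
    grind
  rw [degR, h]
  exact Set.ncard_insert_of_notMem hxw

lemma degR_moveEdge_of_ne [Finite V] (hvw : H.Adj v w) (hxw : ¬ H.Adj x w) (hne : x ≠ w)
    {y : V} (hyv : y ≠ v) (hyx : y ≠ x) :
    degR (moveEdge H v w x) y = degR H y := by
  by_cases hy : y = w
  · subst hy
    have h : (moveEdge H v y x).neighborSet y = insert x (H.neighborSet y \ {v}) := by
      ext z
      simp only [mem_neighborSet, moveEdge_adj hne, Set.mem_insert_iff, Set.mem_sdiff,
        Set.mem_singleton_iff, Sym2.eq_iff, ne_eq]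
      grind
    rw [degR, h, Set.ncard_insert_of_notMem, Set.ncard_sdiff_singleton_add_one, degR]
    · exact hvw.symm
    · exact fun hx => hxw hx.1.symm
  · have h : (moveEdge H v w x).neighborSet y = H.neighborSet y := by
      ext z
      simp only [mem_neighborSet, moveEdge_adj hne, Sym2.eq_iff, ne_eq]
      grind
    rw [degR, h, degR]

end MoveEdge

lemma one_div_sqrt_bounds {x l r : ℝ} (hr : 0 < r) (hx : 0 < x)
    (h1 : l ^ 2 * x < 1) (h2 : 1 < r ^ 2 * x) :
    l < 1 / Real.sqrt x ∧ 1 / Real.sqrt x < r := by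
  have hs := Real.sqrt_pos.2 hx
  have hsq := Real.sq_sqrt hx.le
  rw [lt_div_iff₀ hs, div_lt_iff₀ hs]
  constructor
  · refine lt_of_pow_lt_pow_left₀ 2 zero_le_one ?_
    rw [mul_pow, hsq]; simpa using h1
  · refine lt_of_pow_lt_pow_left₀ 2 (by positivity) ?_
    rw [mul_pow, hsq]; simpa using h2

lemma one_div_sqrt_sub_lower {d : ℕ} (hd : d ≤ 5) :
    (123 : ℝ) / 10000 < 1 / Real.sqrt (2 + d) - 1 / Real.sqrt (3 + d) := by
  interval_cases d <;> push_cast <;> norm_num1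
  · have := one_div_sqrt_bounds (x := 2) (l := 0.7) (r := 0.71)
    have := one_div_sqrt_bounds (x := 3) (l := 0.57) (r := 0.58)
    norm_num at *; linarith
  · have := one_div_sqrt_bounds (x := 3) (l := 0.57) (r := 0.58)
    norm_num at *; linarith
  · have := one_div_sqrt_bounds (x := 5) (l := 0.44) (r := 0.45)
    norm_num at *; linarith
  · have := one_div_sqrt_bounds (x := 5) (l := 0.44) (r := 0.45)
    have := one_div_sqrt_bounds (x := 6) (l := 0.4) (r := 0.41)
    norm_num at *; linarith
  · have := one_div_sqrt_bounds (x := 6) (l := 0.408) (r := 0.41)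
    have := one_div_sqrt_bounds (x := 7) (l := 0.377) (r := 0.378)
    norm_num at *; linarith
  · have := one_div_sqrt_bounds (x := 7) (l := 0.377) (r := 0.378)
    have := one_div_sqrt_bounds (x := 8) (l := 0.353) (r := 0.354)
    norm_num at *; linarith

lemma path_edges_loss_bound :
    (-246 : ℝ) / 10000 < 1 / Real.sqrt (2 + 2) - 1 / Real.sqrt (3 + 2) +
      (1 / Real.sqrt (2 + 2) - 1 / Real.sqrt (2 + 1)) := by
  have h4 : Real.sqrt (2 + 2) = 2 := by
    rw [show (2 + 2 : ℝ) = 2 ^ 2 by norm_num, Real.sqrt_sq (by norm_num)]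
  have h5 := one_div_sqrt_bounds (x := 3 + 2) (l := 0.4472) (r := 0.44722)
  have h3 := one_div_sqrt_bounds (x := 2 + 1) (l := 0.577) (r := 0.57736)
  rw [h4]
  have h5' := (h5 (by norm_num) (by norm_num) (by norm_num) (by norm_num)).2
  have h3' := (h3 (by norm_num) (by norm_num) (by norm_num) (by norm_num)).2
  norm_num at h5' h3' ⊢
  linarith

end PathRerouting

open PathRerouting in
/-- Let `M` be a connected graph with maximum degree at most five, `u` a vertex of
degree `2` in `M` with neighbors `u₁, u₂`, and let `H` be obtained from `M` by
attaching a path `P_a` (`a ≥ 1`) to `u`, with pendent end-vertex `u′` of the attached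
path. Let `H′ = H − uu₂ + u′u₂`. Then `χ(H′) > χ(H)`. -/
theorem stmt_13 {W : Type*} [Fintype W] (M : SimpleGraph W) (hconn : M.Connected)
    (u u₁ u₂ : W) (h1 : M.Adj u u₁) (h2 : M.Adj u u₂) (h12 : u₁ ≠ u₂)
    (hdeg : degR M u = 2) (hmax : ∀ v : W, degR M v ≤ 5)
    (a : ℕ) (ha : 1 ≤ a) :
    sumConn ((attachPath M u a).deleteEdges {s(Sum.inl u, Sum.inl u₂)} ⊔
        SimpleGraph.fromEdgeSet
          {s(Sum.inr (⟨a - 1, Nat.sub_lt ha Nat.one_pos⟩ : Fin a), Sum.inl u₂)}) >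
      sumConn (attachPath M u a) := by
  classical
  have hu := adj_iff_of_degR_eq_two h1 h2 h12 hdeg
  set H := attachPath M u a with hH
  set t : W ⊕ Fin a := Sum.inr ⟨a - 1, Nat.sub_lt ha Nat.one_pos⟩ with ht
  change sumConn (moveEdge H (Sum.inl u) (Sum.inl u₂) t) > sumConn H
  have hvw : H.Adj (Sum.inl u) (Sum.inl u₂) := by simpa [hH] using h2
  have hxw : ¬ H.Adj t (Sum.inl u₂) := by simp [hH, ht, h2.ne']
  have hne : t ≠ Sum.inl u₂ := by simp [ht]
  have hvt : Sum.inl u ≠ t := by simp [ht]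
  rw [gt_iff_lt, ← sub_pos, sumConn_moveEdge_sub hvw hxw hne]
  have dHu : degR H (Sum.inl u) = 3 := by
    rw [degR, Set.ncard_eq_three]
    refine ⟨Sum.inl u₁, Sum.inl u₂, Sum.inr ⟨0, ha⟩, by simpa using h12, by simp, by simp, ?_⟩
    ext (x | x) <;> simp [hH, hu, Fin.ext_iff]
  have dHt : degR H t = 1 := degR_attachPath_last _
  set H' := moveEdge H (Sum.inl u) (Sum.inl u₂) t with hH'
  have dHu' : degR H' (Sum.inl u) = 2 := by
    have : degR H' (Sum.inl u) + 1 = degR H (Sum.inl u) := degR_moveEdge_old hvw hvt hne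
    omega
  have dHt' : degR H' t = 2 := by
    rw [hH', degR_moveEdge_new hxw hvt hne, dHt]
  have dH' : ∀ y, y ≠ Sum.inl u → y ≠ t → degR H' y = degR H y := fun y hy hy' =>
    degR_moveEdge_of_ne hvw hxw hne hy hy'
  have dW : ∀ w, w ≠ u → degR H (Sum.inl w) = degR M w := fun w hw => degR_attachPath_inl hw
  have dW' : ∀ w, w ≠ u → degR H' (Sum.inl w) = degR M w := fun w hw => by
    rw [dH' _ (by simpa using hw) (by simp [ht]), dW w hw]
  have g1 := one_div_sqrt_sub_lower (hmax u₁)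
  have g2 := one_div_sqrt_sub_lower (hmax u₂)
  set K := (H.deleteEdges {s(Sum.inl u, Sum.inl u₂)}).edgeSet.toFinite.toFinset with hK
  have sum_K : ∀ S : Finset (Sym2 (W ⊕ Fin a)), S ⊆ K →
      (∀ y, s(Sum.inl u, y) ∈ K → s(Sum.inl u, y) ∈ S) → (∀ y, s(t, y) ∈ K → s(t, y) ∈ S) →
      ∑ e ∈ K, (edgeWeight H' e - edgeWeight H e) =
        ∑ e ∈ S, (edgeWeight H' e - edgeWeight H e) := by
    intro S hSK hSu hSt
    refine (Finset.sum_subset hSK fun e heK heS => ?_).symm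
    induction e with | _ x y
    have heK' : s(y, x) ∈ K := Sym2.eq_swap ▸ heK
    have heS' : s(y, x) ∉ S := Sym2.eq_swap ▸ heS
    have hx : x ≠ Sum.inl u := by rintro rfl; exact heS (hSu y heK)
    have hx' : x ≠ t := by rintro rfl; exact heS (hSt y heK)
    have hy : y ≠ Sum.inl u := by rintro rfl; exact heS' (hSu x heK')
    have hy' : y ≠ t := by rintro rfl; exact heS' (hSt x heK')
    simp [dH' x hx hx', dH' y hy hy']
  have mem_K : ∀ x y, s(x, y) ∈ K ↔ H.Adj x y ∧ s(x, y) ≠ s(Sum.inl u, Sum.inl u₂) := by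
    intro x y
    simp [hK]
  have K_u : ∀ y, s(Sum.inl u, y) ∈ K ↔ y = Sum.inl u₁ ∨ y = Sum.inr ⟨0, ha⟩ := by
    rintro (y | y)
    · simp only [mem_K, hH, attachPath_adj_inl_inl, hu]
      simp
      grind
    · simp [mem_K, hH, Fin.ext_iff]
  rcases ha.eq_or_lt with rfl | ha2
  · have K_t : ∀ y, s(t, y) ∈ K ↔ y = Sum.inl u := by
      rintro (y | y)
      · simp [mem_K, hH, ht]
      · simp [mem_K, hH, ht]
    rw [sum_K {s(Sum.inl u, Sum.inl u₁), s(Sum.inl u, t)}]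
    · rw [Finset.sum_pair (by simp [ht])]
      simp only [edgeWeight_mk, dHu, dHu', dHt, dHt', dW _ h1.ne', dW' _ h1.ne', dW _ h2.ne',
        dW' _ h2.ne']
      norm_num at g1 g2 ⊢
      linarith
    · simp [Finset.insert_subset_iff, K_u, ht]
    · intro y hy
      rcases (K_u y).1 hy with rfl | rfl <;> simp [ht]
    · intro y hy
      rw [(K_t y).1 hy, Sym2.eq_swap]
      simp
  · set p : W ⊕ Fin a := Sum.inr ⟨0, ha⟩ with hp
    set q : W ⊕ Fin a := Sum.inr ⟨a - 2, by omega⟩ with hq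
    have hpt : p ≠ t := by simp [hp, ht]; omega
    have hqt : q ≠ t := by simp [hq, ht]; omega
    have hpu : p ≠ Sum.inl u := by simp [hp]
    have hqu : q ≠ Sum.inl u := by simp [hq]
    have dp : degR H p = 2 := degR_attachPath_inr _ ha2
    have dq : degR H q = 2 := degR_attachPath_inr _ (by omega)
    have K_t : ∀ y, s(t, y) ∈ K ↔ y = q := by
      rintro (y | y)
      · simp [mem_K, hH, ht, hq]; omega
      · simp [mem_K, hH, ht, hq, Fin.ext_iff]; omega
    rw [sum_K {s(Sum.inl u, Sum.inl u₁), s(Sum.inl u, p), s(t, q)}]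
    · rw [Finset.sum_insert (by simp [ht, hp]), Finset.sum_pair (by simp [ht, hq])]
      simp only [edgeWeight_mk, dHu, dHu', dHt, dHt', dW _ h1.ne', dW' _ h1.ne', dW _ h2.ne',
        dW' _ h2.ne', dH' p hpu hpt, dH' q hqu hqt, dp, dq]
      have g3 := path_edges_loss_bound
      push_cast
      rw [add_comm (1 : ℝ) 2]
      linarith
    · simp [Finset.insert_subset_iff, K_u, K_t]
    · intro y hy
      rcases (K_u y).1 hy with rfl | rfl <;> simp
    · intro y hy
      rw [(K_t y).1 hy]
      simp
end

section
/- Let M be a connected finite simple graph with a vertex u of degree 3 in M such that at least two neighbors of u in M have degree two, let u₂ be a neighbor of u in M with degree 2 in M, let H be the graph obtained from M by attaching a path P_a (a ≥ 1, on a new vertices) to u, and let u′ be the pendent end-vertex of the attached path. Let H′ = H − uu₂ + u′u₂ (delete the edge uu₂ and add the edge u′u₂). Then χ(H′) > χ(H). -/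
open SimpleGraph

/-- The weight `1/√(d(u)+d(v))` of an unordered pair `uv`. -/
noncomputable def pairWeight {V : Type*} (G : SimpleGraph V) (e : Sym2 V) : ℝ :=
  Sym2.lift ⟨fun u v => (1 : ℝ) / Real.sqrt ((degR G u : ℝ) + (degR G v : ℝ)),
    fun u v => by simp [add_comm]⟩ e

lemma pairWeight_mk {V : Type*} (G : SimpleGraph V) (x y : V) :
    pairWeight G s(x, y) = 1 / Real.sqrt ((degR G x : ℝ) + (degR G y : ℝ)) := rfl

lemma degR_pos_of_adj {V : Type*} [Finite V] {G : SimpleGraph V} {x y : V} (h : G.Adj x y) :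
    0 < degR G x :=
  (Set.ncard_pos (Set.toFinite _)).2 ⟨y, h⟩

/-- The graph obtained from `G` by replacing the edge `xy` with the edge `zy`. -/
def moveEdge {V : Type*} (G : SimpleGraph V) (x y z : V) : SimpleGraph V :=
  G.deleteEdges {s(x, y)} ⊔ SimpleGraph.fromEdgeSet {s(z, y)}

section MoveEdge

variable {V : Type*} {G : SimpleGraph V} {x y z : V}

lemma moveEdge_adj (hzy : z ≠ y) (v w : V) :
    (moveEdge G x y z).Adj v w ↔
      (G.Adj v w ∧ s(v, w) ≠ s(x, y)) ∨ s(v, w) = s(z, y) := by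
  simp only [moveEdge, SimpleGraph.sup_adj, SimpleGraph.deleteEdges_adj,
    SimpleGraph.fromEdgeSet_adj, Set.mem_singleton_iff]
  constructor
  · tauto
  · rintro (h | h)
    · exact Or.inl h
    · refine Or.inr ⟨h, ?_⟩
      rintro rfl
      simp only [Sym2.eq_iff] at h
      grind

lemma degR_moveEdge_source [Finite V] (hxy : G.Adj x y) (hzx : z ≠ x) (hzy : z ≠ y) :
    degR (moveEdge G x y z) x + 1 = degR G x := by
  have h : (moveEdge G x y z).neighborSet x = G.neighborSet x \ {y} := by
    have := hxy.ne
    ext w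
    simp only [SimpleGraph.mem_neighborSet, moveEdge_adj hzy, Set.mem_sdiff,
      Set.mem_singleton_iff, Sym2.eq_iff]
    grind
  rw [degR, degR, h]
  exact Set.ncard_sdiff_singleton_add_one (by simpa using hxy) (Set.toFinite _)

lemma degR_moveEdge_target [Finite V] (hzx : z ≠ x) (hzy : z ≠ y) (hn : ¬ G.Adj z y) :
    degR (moveEdge G x y z) z = degR G z + 1 := by
  have h : (moveEdge G x y z).neighborSet z = insert y (G.neighborSet z) := by
    ext w
    simp only [SimpleGraph.mem_neighborSet, moveEdge_adj hzy, Set.mem_insert_iff, Sym2.eq_iff]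
    grind
  rw [degR, degR, h]
  exact Set.ncard_insert_of_notMem (by simpa using hn) (Set.toFinite _)

lemma degR_moveEdge_pivot [Finite V] (hxy : G.Adj x y) (hzy : z ≠ y)
    (hn : ¬ G.Adj z y) : degR (moveEdge G x y z) y = degR G y := by
  have h : (moveEdge G x y z).neighborSet y = insert z (G.neighborSet y \ {x}) := by
    have := hxy.ne
    ext w
    simp only [SimpleGraph.mem_neighborSet, moveEdge_adj hzy, Set.mem_insert_iff,
      Set.mem_sdiff, Set.mem_singleton_iff, Sym2.eq_iff]
    grind
  rw [degR, degR, h, Set.ncard_insert_of_notMem _ (Set.toFinite _)]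
  · exact Set.ncard_sdiff_singleton_add_one (by simpa using hxy.symm) (Set.toFinite _)
  · simp only [Set.mem_sdiff, SimpleGraph.mem_neighborSet, not_and]
    exact fun h => absurd h.symm hn

lemma degR_moveEdge_of_ne (hzy : z ≠ y) {v : V} (hx : v ≠ x) (hy : v ≠ y) (hz : v ≠ z) :
    degR (moveEdge G x y z) v = degR G v := by
  have h : (moveEdge G x y z).neighborSet v = G.neighborSet v := by
    ext w
    simp only [SimpleGraph.mem_neighborSet, moveEdge_adj hzy, Sym2.eq_iff]
    grind
  rw [degR, degR, h]

lemma degR_moveEdge_le [Finite V] (hxy : G.Adj x y) (hzx : z ≠ x) (hzy : z ≠ y)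
    (hn : ¬ G.Adj z y) {v : V} (hv : v ≠ z) : degR (moveEdge G x y z) v ≤ degR G v := by
  by_cases hvx : v = x
  · subst hvx
    exact (Nat.le_succ _).trans (degR_moveEdge_source hxy hzx hzy).le
  · by_cases hvy : v = y
    · subst hvy
      exact (degR_moveEdge_pivot hxy hzy hn).le
    · exact (degR_moveEdge_of_ne hzy hvx hvy hv).le

lemma pairWeight_le_moveEdge [Finite V] (hxy : G.Adj x y) (hzx : z ≠ x) (hzy : z ≠ y)
    (hn : ¬ G.Adj z y) {v w : V} (h : G.Adj v w) (hne : s(v, w) ≠ s(x, y))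
    (hv : v ≠ z) (hw : w ≠ z) :
    pairWeight G s(v, w) ≤ pairWeight (moveEdge G x y z) s(v, w) := by
  rw [pairWeight_mk, pairWeight_mk]
  have hpos : 0 < degR (moveEdge G x y z) v :=
    degR_pos_of_adj ((moveEdge_adj hzy v w).2 (Or.inl ⟨h, hne⟩))
  have h1 := degR_moveEdge_le hxy hzx hzy hn hv
  have h2 := degR_moveEdge_le hxy hzx hzy hn hw
  have hpos' : (0 : ℝ) < (degR (moveEdge G x y z) v : ℝ) + degR (moveEdge G x y z) w := by
    positivity
  apply one_div_le_one_div_of_le (Real.sqrt_pos.2 hpos')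
  apply Real.sqrt_le_sqrt
  exact_mod_cast add_le_add h1 h2

/-- A lower bound for the change of the sum-connectivity index when an edge is moved, by the
contributions of the moved edge and of any set `S` of other edges, provided that the edges
outside `S` do not lose weight. -/
lemma sumConn_add_le_sumConn_moveEdge [Fintype V] (hxy : G.Adj x y) (hzy : z ≠ y)
    (hn : ¬ G.Adj z y) (S : Finset (Sym2 V))
    (hS : ∀ e ∈ S, e ∈ G.edgeSet ∧ e ≠ s(x, y))
    (hle : ∀ e ∈ G.edgeSet, e ≠ s(x, y) → e ∉ S →
      pairWeight G e ≤ pairWeight (moveEdge G x y z) e) :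
    sumConn G + (pairWeight (moveEdge G x y z) s(z, y) - pairWeight G s(x, y) +
      ∑ e ∈ S, (pairWeight (moveEdge G x y z) e - pairWeight G e)) ≤
      sumConn (moveEdge G x y z) := by
  classical
  set E := G.edgeSet.toFinite.toFinset with hE
  have hmem : ∀ e, e ∈ E ↔ e ∈ G.edgeSet := fun e => by simp [hE]
  have h1 : sumConn G = pairWeight G s(x, y) + ∑ e ∈ E.erase s(x, y), pairWeight G e :=
    (Finset.add_sum_erase E (pairWeight G) ((hmem _).2 hxy)).symm
  have hins : (moveEdge G x y z).edgeSet.toFinite.toFinset =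
      insert s(z, y) (E.erase s(x, y)) := by
    ext e
    induction e with
    | _ v w =>
      simp only [Set.Finite.mem_toFinset, Finset.mem_insert, Finset.mem_erase, hmem,
        SimpleGraph.mem_edgeSet, moveEdge_adj hzy]
      tauto
  have h2 : sumConn (moveEdge G x y z) = pairWeight (moveEdge G x y z) s(z, y) +
      ∑ e ∈ E.erase s(x, y), pairWeight (moveEdge G x y z) e := by
    have hnot : s(z, y) ∉ E.erase s(x, y) := by
      simp only [Finset.mem_erase, hmem, SimpleGraph.mem_edgeSet, not_and]
      exact fun _ => hn
    rw [← Finset.sum_insert hnot, ← hins]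
    rfl
  have h3 : ∑ e ∈ S, (pairWeight (moveEdge G x y z) e - pairWeight G e) ≤
      ∑ e ∈ E.erase s(x, y), (pairWeight (moveEdge G x y z) e - pairWeight G e) := by
    apply Finset.sum_le_sum_of_subset_of_nonneg
    · intro e he
      exact Finset.mem_erase.2 ⟨(hS e he).2, (hmem e).2 (hS e he).1⟩
    · intro e he heS
      have := Finset.mem_erase.1 he
      exact sub_nonneg.2 (hle e ((hmem e).1 this.2) this.1 heS)
  rw [Finset.sum_sub_distrib, Finset.sum_sub_distrib] at h3
  rw [Finset.sum_sub_distrib]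
  linarith

end MoveEdge

lemma two_div_sqrt_six_lt : 2 / √6 < 1 / √5 + 1 / √(4 : ℝ) := by
  have h4 : √(4 : ℝ) = 2 := by rw [show (4 : ℝ) = 2 ^ 2 by norm_num]; simp
  have h5 : √(5 : ℝ) ≤ 2.24 := Real.sqrt_le_iff.2 (by norm_num)
  have h6 : 2.44 ≤ √(6 : ℝ) := Real.le_sqrt_of_sq_le (by norm_num)
  have a5 : 1 / 2.24 ≤ 1 / √(5 : ℝ) := one_div_le_one_div_of_le (by positivity) h5
  have a6 : 2 / √(6 : ℝ) ≤ 2 / 2.44 := div_le_div_of_nonneg_left (by norm_num) (by norm_num) h6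
  rw [h4]
  norm_num at *
  linarith

lemma three_div_sqrt_six_add_lt :
    3 / √6 + 1 / √3 < 2 / √5 + 2 / √(4 : ℝ) := by
  have h4 : √(4 : ℝ) = 2 := by rw [show (4 : ℝ) = 2 ^ 2 by norm_num]; simp
  have h3 : 1.73 ≤ √(3 : ℝ) := Real.le_sqrt_of_sq_le (by norm_num)
  have h5 : √(5 : ℝ) ≤ 2.24 := Real.sqrt_le_iff.2 (by norm_num)
  have h6 : 2.44 ≤ √(6 : ℝ) := Real.le_sqrt_of_sq_le (by norm_num)
  have a3 : 1 / √(3 : ℝ) ≤ 1 / 1.73 := div_le_div_of_nonneg_left (by norm_num) (by norm_num) h3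
  have a5 : 2 / 2.24 ≤ 2 / √(5 : ℝ) := div_le_div_of_nonneg_left (by norm_num) (by positivity) h5
  have a6 : 3 / √(6 : ℝ) ≤ 3 / 2.44 := div_le_div_of_nonneg_left (by norm_num) (by norm_num) h6
  rw [h4]
  norm_num at *
  linarith

section Increase

variable {V : Type*} [Fintype V] {G : SimpleGraph V} {x y z w : V}

/-- Moving an edge at a vertex `x` of degree four to a pendent neighbour `z` of `x`. -/
lemma sumConn_lt_moveEdge_of_adj (hxy : G.Adj x y) (hxw : G.Adj x w) (hwy : w ≠ y)
    (hzy : z ≠ y) (hn : ¬ G.Adj z y) (hz : G.neighborSet z = {x})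
    (hdx : degR G x = 4) (hdy : degR G y = 2) (hdw : degR G w = 2) :
    sumConn G < sumConn (moveEdge G x y z) := by
  classical
  have hzx : z ≠ x := by
    rintro rfl
    exact G.loopless.irrefl z (by rw [← SimpleGraph.mem_neighborSet, hz]; rfl)
  have hdz : degR G z = 1 := by rw [degR, hz, Set.ncard_singleton]
  have hwz : w ≠ z := by
    rintro rfl
    omega
  have hx' : degR (moveEdge G x y z) x = 3 := by
    have := degR_moveEdge_source hxy hzx hzy
    omega
  have hz' : degR (moveEdge G x y z) z = 2 := by
    rw [degR_moveEdge_target hzx hzy hn, hdz]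
  have hy' : degR (moveEdge G x y z) y = 2 := by
    rw [degR_moveEdge_pivot hxy hzy hn, hdy]
  have hw' : degR (moveEdge G x y z) w = 2 := by
    rw [degR_moveEdge_of_ne hzy hxw.ne' hwy hwz, hdw]
  have key := sumConn_add_le_sumConn_moveEdge hxy hzy hn {s(x, w)} (by
      intro e he
      rw [Finset.mem_singleton] at he
      subst he
      refine ⟨hxw, ?_⟩
      simp only [ne_eq, Sym2.eq_iff]
      have := hxy.ne
      grind) (by
      intro e he hne _
      induction e with
      | _ v t =>
        rw [SimpleGraph.mem_edgeSet] at he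
        have hN : ∀ t, G.Adj z t → t = x := fun t ht => by
          rw [← SimpleGraph.mem_neighborSet, hz] at ht
          exact ht
        by_cases hv : v = z
        · subst hv
          obtain rfl := hN t he
          rw [pairWeight_mk, pairWeight_mk, hx', hz', hdx, hdz]
          norm_num
        · by_cases ht : t = z
          · subst ht
            obtain rfl := hN v he.symm
            rw [pairWeight_mk, pairWeight_mk, hx', hz', hdx, hdz]
            norm_num
          · exact pairWeight_le_moveEdge hxy hzx hzy hn he hne hv ht)
  rw [Finset.sum_singleton] at key
  simp only [pairWeight_mk, hx', hy', hz', hw', hdx, hdy, hdw] at key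
  have := two_div_sqrt_six_lt
  norm_num at key this
  ring_nf at key this
  linarith

/-- Moving an edge at a vertex `x` of degree four to a pendent vertex `z` not adjacent to `x`,
where `x` has two further neighbours `w`, `p` of degree two, and the neighbour `q` of `z` has
degree two. -/
lemma sumConn_lt_moveEdge_of_not_adj {p q : V} (hxy : G.Adj x y) (hxw : G.Adj x w)
    (hxp : G.Adj x p) (hwy : w ≠ y) (hpy : p ≠ y) (hpw : p ≠ w) (hqx : q ≠ x) (hqy : q ≠ y)
    (hzx : z ≠ x) (hzy : z ≠ y) (hz : G.neighborSet z = {q})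
    (hdx : degR G x = 4) (hdy : degR G y = 2) (hdw : degR G w = 2) (hdp : degR G p = 2)
    (hdq : degR G q = 2) :
    sumConn G < sumConn (moveEdge G x y z) := by
  classical
  have hN : ∀ t, G.Adj z t ↔ t = q := fun t => by
    rw [← SimpleGraph.mem_neighborSet, hz, Set.mem_singleton_iff]
  have hn : ¬ G.Adj z y := fun h => hqy ((hN y).1 h).symm
  have hqz : q ≠ z := ((hN q).2 rfl).ne'
  have hdz : degR G z = 1 := by rw [degR, hz, Set.ncard_singleton]
  have hwz : w ≠ z := by
    rintro rfl
    omega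
  have hpz : p ≠ z := by
    rintro rfl
    omega
  have hx' : degR (moveEdge G x y z) x = 3 := by
    have := degR_moveEdge_source hxy hzx hzy
    omega
  have hz' : degR (moveEdge G x y z) z = 2 := by
    rw [degR_moveEdge_target hzx hzy hn, hdz]
  have hy' : degR (moveEdge G x y z) y = 2 := by
    rw [degR_moveEdge_pivot hxy hzy hn, hdy]
  have hw' : degR (moveEdge G x y z) w = 2 := by
    rw [degR_moveEdge_of_ne hzy hxw.ne' hwy hwz, hdw]
  have hp' : degR (moveEdge G x y z) p = 2 := by
    rw [degR_moveEdge_of_ne hzy hxp.ne' hpy hpz, hdp]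
  have hq' : degR (moveEdge G x y z) q = 2 := by
    rw [degR_moveEdge_of_ne hzy hqx hqy hqz, hdq]
  have hxw_ne := hxw.ne
  have hxp_ne := hxp.ne
  have hxy_ne := hxy.ne
  have key := sumConn_add_le_sumConn_moveEdge hxy hzy hn {s(x, w), s(x, p), s(z, q)} (by
      intro e he
      simp only [Finset.mem_insert, Finset.mem_singleton] at he
      rcases he with rfl | rfl | rfl
      · refine ⟨hxw, ?_⟩
        simp only [ne_eq, Sym2.eq_iff]
        grind
      · refine ⟨hxp, ?_⟩
        simp only [ne_eq, Sym2.eq_iff]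
        grind
      · refine ⟨(hN q).2 rfl, ?_⟩
        simp only [ne_eq, Sym2.eq_iff]
        grind) (by
      intro e he hne heS
      induction e with
      | _ v t =>
        rw [SimpleGraph.mem_edgeSet] at he
        simp only [Finset.mem_insert, Finset.mem_singleton, not_or] at heS
        refine pairWeight_le_moveEdge hxy hzx hzy hn he hne ?_ ?_
        · rintro rfl
          exact heS.2.2 (by rw [(hN t).1 he])
        · rintro rfl
          exact heS.2.2 (by rw [(hN v).1 he.symm, Sym2.eq_swap]))
  rw [Finset.sum_insert, Finset.sum_insert, Finset.sum_singleton] at key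
  · simp only [pairWeight_mk, hx', hy', hz', hw', hp', hq', hdx, hdy, hdz, hdw, hdp, hdq] at key
    have := three_div_sqrt_six_add_lt
    norm_num at key this
    ring_nf at key this
    linarith
  · simp only [Finset.mem_singleton, Sym2.eq_iff]
    grind
  · simp only [Finset.mem_insert, Finset.mem_singleton, Sym2.eq_iff]
    grind

end Increase

section AttachPath

variable {W : Type*} {M : SimpleGraph W} {u : W} {a : ℕ}

@[simp]
lemma attachPath_adj_inl_inl (v w : W) :
    (attachPath M u a).Adj (Sum.inl v) (Sum.inl w) ↔ M.Adj v w := by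
  simp only [attachPath, SimpleGraph.fromRel_adj]
  constructor
  · rintro ⟨-, h⟩
    simp [M.adj_comm w v] at h
    exact h
  · intro h
    exact ⟨by simpa using h.ne, by simp [h]⟩

@[simp]
lemma attachPath_adj_inl_inr (v : W) (i : Fin a) :
    (attachPath M u a).Adj (Sum.inl v) (Sum.inr i) ↔ v = u ∧ (i : ℕ) = 0 := by
  have := i.pos
  simp only [attachPath, SimpleGraph.fromRel_adj]
  simp [Fin.ext_iff, this]

@[simp]
lemma attachPath_adj_inr_inl (v : W) (i : Fin a) :
    (attachPath M u a).Adj (Sum.inr i) (Sum.inl v) ↔ v = u ∧ (i : ℕ) = 0 := by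
  rw [SimpleGraph.adj_comm, attachPath_adj_inl_inr]

@[simp]
lemma attachPath_adj_inr_inr (i j : Fin a) :
    (attachPath M u a).Adj (Sum.inr i) (Sum.inr j) ↔
      (j : ℕ) = i + 1 ∨ (i : ℕ) = j + 1 := by
  simp only [attachPath, SimpleGraph.fromRel_adj]
  simp only [ne_eq, Sum.inr.injEq, reduceCtorEq, false_and, exists_false, false_or,
    exists_and_left, Fin.ext_iff]
  grind

lemma degR_attachPath_inl_of_ne {v : W} (hv : v ≠ u) :
    degR (attachPath M u a) (Sum.inl v) = degR M v := by
  have h : (attachPath M u a).neighborSet (Sum.inl v) = Sum.inl '' M.neighborSet v := by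
    ext (w | i) <;> simp [hv]
  rw [degR, degR, h, Set.ncard_image_of_injective _ Sum.inl_injective]

lemma degR_attachPath_inl_self [Finite W] (ha : 0 < a) :
    degR (attachPath M u a) (Sum.inl u) = degR M u + 1 := by
  have h : (attachPath M u a).neighborSet (Sum.inl u) =
      insert (Sum.inr ⟨0, ha⟩) (Sum.inl '' M.neighborSet u) := by
    ext (w | i) <;> simp [Fin.ext_iff]
  rw [degR, degR, h, Set.ncard_insert_of_notMem (by simp) (Set.toFinite _),
    Set.ncard_image_of_injective _ Sum.inl_injective]

lemma degR_attachPath_inr (i : Fin a) (hi : (i : ℕ) + 1 < a) :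
    degR (attachPath M u a) (Sum.inr i) = 2 := by
  by_cases h0 : (i : ℕ) = 0
  · have h : (attachPath M u a).neighborSet (Sum.inr i) =
        {Sum.inl u, Sum.inr ⟨i + 1, hi⟩} := by
      ext (w | j)
      · simp [h0]
      · simp [Fin.ext_iff]
        omega
    rw [degR, h, Set.ncard_pair (by simp)]
  · have h : (attachPath M u a).neighborSet (Sum.inr i) =
        {Sum.inr ⟨i - 1, by omega⟩, Sum.inr ⟨i + 1, hi⟩} := by
      ext (w | j)
      · simp [h0]
      · simp [Fin.ext_iff]
        omega
    rw [degR, h, Set.ncard_pair]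
    simp [Fin.ext_iff]

end AttachPath

/-- Let `M` be a connected graph, `u` a vertex of degree `3` in `M` having at least two
neighbors of degree two, and `u₂` a neighbor of `u` of degree `2` in `M`. Let `H` be
obtained from `M` by attaching a path `P_a` (`a ≥ 1`) to `u`, with pendent end-vertex
`u′` of the attached path, and let `H′ = H − uu₂ + u′u₂`. Then `χ(H′) > χ(H)`. -/
theorem stmt_14 {W : Type*} [Fintype W] (M : SimpleGraph W) (hconn : M.Connected)
    (u u₂ : W) (h2 : M.Adj u u₂) (hdeg : degR M u = 3)
    (htwo : ∃ w₁ w₂ : W, w₁ ≠ w₂ ∧ M.Adj u w₁ ∧ M.Adj u w₂ ∧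
      degR M w₁ = 2 ∧ degR M w₂ = 2)
    (hdeg2 : degR M u₂ = 2)
    (a : ℕ) (ha : 1 ≤ a) :
    sumConn ((attachPath M u a).deleteEdges {s(Sum.inl u, Sum.inl u₂)} ⊔
        SimpleGraph.fromEdgeSet
          {s(Sum.inr (⟨a - 1, Nat.sub_lt ha Nat.one_pos⟩ : Fin a), Sum.inl u₂)}) >
      sumConn (attachPath M u a) := by
  obtain ⟨w, hwu₂, huw, hdw⟩ : ∃ w, w ≠ u₂ ∧ M.Adj u w ∧ degR M w = 2 := by
    obtain ⟨w₁, w₂, hne, h₁, h₂, hd₁, hd₂⟩ := htwo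
    by_cases h : w₁ = u₂
    · exact ⟨w₂, fun h' => hne (h.trans h'.symm), h₂, hd₂⟩
    · exact ⟨w₁, h, h₁, hd₁⟩
  have hdu : degR (attachPath M u a) (Sum.inl u) = 4 := by
    rw [degR_attachPath_inl_self ha, hdeg]
  have hdu₂ : degR (attachPath M u a) (Sum.inl u₂) = 2 := by
    rw [degR_attachPath_inl_of_ne h2.ne', hdeg2]
  have hdw' : degR (attachPath M u a) (Sum.inl w) = 2 := by
    rw [degR_attachPath_inl_of_ne huw.ne', hdw]
  change sumConn (attachPath M u a) < sumConn (moveEdge (attachPath M u a) (Sum.inl u)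
    (Sum.inl u₂) (Sum.inr ⟨a - 1, Nat.sub_lt ha Nat.one_pos⟩))
  rcases ha.eq_or_lt with rfl | ha'
  · refine sumConn_lt_moveEdge_of_adj (w := Sum.inl w) (by simpa using h2) (by simpa using huw)
      (by simpa using hwu₂) (by simp) (by simpa using h2.ne') ?_ hdu hdu₂ hdw'
    ext (v | i) <;> simp
  · refine sumConn_lt_moveEdge_of_not_adj (w := Sum.inl w) (p := Sum.inr ⟨0, ha⟩)
      (q := Sum.inr ⟨a - 2, by omega⟩) (by simpa using h2) (by simpa using huw)
      (by simp) (by simpa using hwu₂) (by simp) (by simp) (by simp) (by simp) (by simp)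
      (by simp) ?_ hdu hdu₂ hdw' (degR_attachPath_inr _ ?_) (degR_attachPath_inr _ ?_)
    · ext (v | i)
      · simp
        omega
      · have := i.isLt
        simp [Fin.ext_iff]
        omega
    · simpa using ha'
    · simp only
      omega
end

section
/- Let n ≥ 7 and let G be a connected graph on n vertices with exactly two cycles, these cycles being vertex-disjoint (i.e., G ∈ 𝔹₁(n)). Then χ(G) ≤ (n−4)/2 + 1/√6 + 4/√5, with equality if and only if G is obtained by joining two vertex-disjoint cycles C_a and C_b with a + b = n by an edge; moreover, if G is not of that form, then χ(G) ≤ (n−5)/2 + 6/√5, with equality if and only if G is obtained by joining two vertex-disjoint cycles C_a and C_b with a + b < n by a path of length n − a − b + 1. -/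
open SimpleGraph

/-- Two vertex-disjoint cycles `C_a` and `C_b` joined by an edge. -/
def twoCyclesEdge (a b : ℕ) : SimpleGraph (Fin a ⊕ Fin b) :=
  SimpleGraph.fromRel (fun x y =>
    (∃ i j, x = Sum.inl i ∧ y = Sum.inl j ∧ (SimpleGraph.cycleGraph a).Adj i j) ∨
    (∃ i j, x = Sum.inr i ∧ y = Sum.inr j ∧ (SimpleGraph.cycleGraph b).Adj i j) ∨
    (∃ (ha : 0 < a) (hb : 0 < b), x = Sum.inl ⟨0, ha⟩ ∧ y = Sum.inr ⟨0, hb⟩))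

/-- Two vertex-disjoint cycles `C_a` and `C_b` joined by a path with `k ≥ 1` internal
vertices, i.e. a path of length `k + 1`. -/
def twoCyclesPath (a b k : ℕ) : SimpleGraph ((Fin a ⊕ Fin b) ⊕ Fin k) :=
  SimpleGraph.fromRel (fun x y =>
    (∃ i j, x = Sum.inl (Sum.inl i) ∧ y = Sum.inl (Sum.inl j) ∧
      (SimpleGraph.cycleGraph a).Adj i j) ∨
    (∃ i j, x = Sum.inl (Sum.inr i) ∧ y = Sum.inl (Sum.inr j) ∧
      (SimpleGraph.cycleGraph b).Adj i j) ∨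
    (∃ (ha : 0 < a) (hk : 0 < k), x = Sum.inl (Sum.inl ⟨0, ha⟩) ∧ y = Sum.inr ⟨0, hk⟩) ∨
    (∃ i j : Fin k, x = Sum.inr i ∧ y = Sum.inr j ∧ (j : ℕ) = (i : ℕ) + 1) ∨
    (∃ (hb : 0 < b) (hk : 0 < k),
      x = Sum.inr ⟨k - 1, Nat.sub_lt hk Nat.one_pos⟩ ∧ y = Sum.inl (Sum.inr ⟨0, hb⟩)))

/-- The cycle `C_a` together with a path with `k ≥ 1` internal vertices (i.e. a path of
length `k + 1`) joining the vertices `x` and `y` of the cycle. -/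
def cyclePlusPath (a k : ℕ) (x y : Fin a) : SimpleGraph (Fin a ⊕ Fin k) :=
  SimpleGraph.fromRel (fun z w =>
    (∃ i j, z = Sum.inl i ∧ w = Sum.inl j ∧ (SimpleGraph.cycleGraph a).Adj i j) ∨
    (∃ hk : 0 < k, z = Sum.inl x ∧ w = Sum.inr ⟨0, hk⟩) ∨
    (∃ i j : Fin k, z = Sum.inr i ∧ w = Sum.inr j ∧ (j : ℕ) = (i : ℕ) + 1) ∨
    (∃ hk : 0 < k, z = Sum.inr ⟨k - 1, Nat.sub_lt hk Nat.one_pos⟩ ∧ w = Sum.inl y))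

/-- `G` belongs to the family `B₁⁽¹⁾(n)`: it is obtained by joining two vertex-disjoint
cycles `C_a` and `C_b` with `a + b = n` by an edge. -/
def IsB1a {V : Type*} (n : ℕ) (G : SimpleGraph V) : Prop :=
  ∃ a b : ℕ, 3 ≤ a ∧ 3 ≤ b ∧ a + b = n ∧ Nonempty (G ≃g twoCyclesEdge a b)

/-- `G` belongs to the family `B₁⁽²⁾(n)`: it is obtained by joining two vertex-disjoint
cycles `C_a` and `C_b` with `a + b < n` by a path of length `n - a - b + 1`. -/
def IsB1b {V : Type*} (n : ℕ) (G : SimpleGraph V) : Prop :=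
  ∃ a b : ℕ, 3 ≤ a ∧ 3 ≤ b ∧ a + b < n ∧ Nonempty (G ≃g twoCyclesPath a b (n - a - b))

/-- `G` belongs to the family `B₃⁽¹⁾(n)`: it is obtained from the cycle `C_n` by adding
an edge (between two distinct non-adjacent vertices). -/
def IsB3a {V : Type*} (n : ℕ) (G : SimpleGraph V) : Prop :=
  ∃ x y : Fin n, x ≠ y ∧ ¬ (SimpleGraph.cycleGraph n).Adj x y ∧
    Nonempty (G ≃g (SimpleGraph.cycleGraph n ⊔ SimpleGraph.fromEdgeSet {s(x, y)}))

/-- `G` belongs to the family `B₃⁽²⁾(n)`: it is obtained by joining two non-adjacent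
vertices of a cycle `C_a` with `4 ≤ a ≤ n - 1` by a path of length `n - a + 1`. -/
def IsB3b {V : Type*} (n : ℕ) (G : SimpleGraph V) : Prop :=
  ∃ (a : ℕ) (x y : Fin a), 4 ≤ a ∧ a ≤ n - 1 ∧ x ≠ y ∧
    ¬ (SimpleGraph.cycleGraph a).Adj x y ∧ Nonempty (G ≃g cyclePlusPath a (n - a) x y)

namespace SumConn

variable {V : Type*} {G : SimpleGraph V}

/-! ### Numerical estimates -/

lemma one_div_sqrt_le_affine {p q : ℕ} (hp : 1 ≤ p) (hq : 1 ≤ q) :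
    1 / √((p : ℝ) + q) ≤ 9 / 40 + 11 / 40 * (1 / p + 1 / q) := by
  have hp' : (1 : ℝ) ≤ p := by exact_mod_cast hp
  have hq' : (1 : ℝ) ≤ q := by exact_mod_cast hq
  have h0 : (0 : ℝ) < (p : ℝ) + q := by linarith
  have hs := Real.sqrt_pos.2 h0
  by_cases h5 : p + q = 5
  · have h5' : (p : ℝ) + q = 5 := by exact_mod_cast h5
    have h : 6 * (1 / (p : ℝ) + 1 / q) ≥ 5 := by
      have hle : p ≤ 4 := by omega
      obtain rfl : q = 5 - p := by omega
      interval_cases p <;> norm_num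
    have hr : 1 / √((p : ℝ) + q) ≤ 9 / 20 := by
      rw [h5', div_le_iff₀ (by positivity)]
      have : (20 : ℝ) / 9 ≤ √5 := Real.le_sqrt_of_sq_le (by norm_num)
      linarith
    linarith
  have hamhm : 4 / ((p : ℝ) + q) ≤ 1 / p + 1 / q := by
    rw [div_add_div _ _ (by positivity) (by positivity), div_le_div_iff₀ h0 (by positivity)]
    nlinarith [sq_nonneg ((p : ℝ) - q)]
  set x := 1 / √((p : ℝ) + q) with hx
  have hx2 : 1 / ((p : ℝ) + q) = x ^ 2 := by
    rw [hx, div_pow, Real.sq_sqrt h0.le, one_pow]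
  have hx0 : 0 < x := by positivity
  have hmul : 0 ≤ (x - 1 / 2) * (x - 9 / 22) := by
    rcases lt_or_gt_of_ne h5 with h | h
    · have : (p : ℝ) + q ≤ 4 := by exact_mod_cast (by omega : p + q ≤ 4)
      have h1 : 1 / (4 : ℝ) ≤ x ^ 2 := by
        rw [← hx2]; exact one_div_le_one_div_of_le h0 this
      have : 1 / 2 ≤ x := by nlinarith
      exact mul_nonneg (by linarith) (by linarith)
    · have : (6 : ℝ) ≤ (p : ℝ) + q := by exact_mod_cast (by omega : 6 ≤ p + q)
      have h1 : x ^ 2 ≤ 1 / (6 : ℝ) := by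
        rw [← hx2]; exact one_div_le_one_div_of_le (by norm_num) this
      have : x ≤ 9 / 22 := by nlinarith
      exact mul_nonneg_of_nonpos_of_nonpos (by linarith) (by linarith)
  have : 4 / ((p : ℝ) + q) = 4 * x ^ 2 := by rw [← hx2]; ring
  nlinarith

lemma one_div_sqrt_one_add_le {q : ℕ} (hq : 1 ≤ q) :
    1 / √((1 : ℝ) + q) ≤ 9 / 40 + 11 / 40 * (1 + 1 / q) - 1 / 20 := by
  have key : ∀ s b : ℝ, 0 < b → 1 ≤ b ^ 2 * s → 1 / √s ≤ b := by
    intro s b hb h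
    have hs : 0 < s := by
      by_contra! hs
      nlinarith [sq_nonneg b]
    rw [div_le_iff₀ (Real.sqrt_pos.2 hs)]
    have : (1 / b) ≤ √s := Real.le_sqrt_of_sq_le (by
      rw [div_pow, div_le_iff₀ (by positivity)]; linarith)
    rw [div_le_iff₀ hb] at this
    linarith
  have hq' : (1 : ℝ) ≤ q := by exact_mod_cast hq
  have hpos : 0 < 1 / (q : ℝ) := by positivity
  refine key _ _ (by linarith) ?_
  by_cases h : q < 4
  · interval_cases q <;> norm_num
  · have : (4 : ℝ) ≤ q := by exact_mod_cast (not_lt.1 h)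
    nlinarith

/-! ### Sums over edges -/

section Counting

variable [Fintype V]

lemma sum_edges_ite_mem (G : SimpleGraph V) [DecidableEq V] (v : V) :
    ∑ e ∈ G.edgeSet.toFinite.toFinset, (if v ∈ e then (1 : ℝ) else 0) = degR G v := by
  classical
  rw [Finset.sum_ite, Finset.sum_const_zero, add_zero, Finset.sum_const, nsmul_eq_mul, mul_one]
  congr 1
  have : degR G v = G.degree v := by
    rw [degR, Set.ncard_eq_toFinset_card', SimpleGraph.degree, SimpleGraph.neighborFinset]
  rw [this, ← G.card_incidenceFinset_eq_degree]
  congr 1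
  ext e
  simp [SimpleGraph.incidenceSet]

lemma sum_ite_mem_sym2 [DecidableEq V] (f : V → ℝ) {u v : V} (h : u ≠ v) :
    ∑ w, (if w ∈ s(u, v) then f w else 0) = f u + f v := by
  rw [← Finset.sum_filter, ← Finset.sum_pair h]
  congr 1
  ext w
  simp

lemma sum_edges_endpoints (G : SimpleGraph V) [DecidableEq V] (f : V → ℝ) :
    ∑ e ∈ G.edgeSet.toFinite.toFinset, ∑ w, (if w ∈ e then f w else 0) =
      ∑ v, degR G v * f v := by
  rw [Finset.sum_comm]
  refine Finset.sum_congr rfl fun v _ ↦ ?_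
  rw [← sum_edges_ite_mem, Finset.sum_mul]
  exact Finset.sum_congr rfl fun e _ ↦ by split_ifs <;> simp

lemma sum_degR (G : SimpleGraph V) : ∑ v, degR G v = 2 * G.edgeSet.ncard := by
  classical
  have h := G.sum_degrees_eq_twice_card_edges
  rw [← SimpleGraph.coe_edgeFinset G, Set.ncard_coe_finset, ← h]
  refine Finset.sum_congr rfl fun v _ ↦ ?_
  rw [degR, Set.ncard_eq_toFinset_card', SimpleGraph.degree, SimpleGraph.neighborFinset]

lemma card_edges_toFinset (G : SimpleGraph V) :
    G.edgeSet.toFinite.toFinset.card = G.edgeSet.ncard :=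
  (Set.ncard_eq_toFinset_card _ _).symm

/-- A bicyclic graph with a pendant vertex falls short of the dumbbell values. -/
lemma sumConn_lt_of_degR_eq_one {n : ℕ} (hcard : Fintype.card V = n)
    (hedges : G.edgeSet.ncard = n + 1) (hpos : ∀ v, 1 ≤ degR G v) {l : V}
    (hl : degR G l = 1) : sumConn G < ((n : ℝ) - 5) / 2 + 6 / √5 := by
  classical
  have hle : sumConn G ≤ ∑ e ∈ G.edgeSet.toFinite.toFinset,
      (9 / 40 + 11 / 40 * (∑ w, if w ∈ e then 1 / (degR G w : ℝ) else 0) -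
        1 / 20 * (if l ∈ e then 1 else 0)) := by
    refine Finset.sum_le_sum fun e he ↦ ?_
    induction e with
    | h u v =>
    have huv : u ≠ v := by
      have : G.Adj u v := by simpa using he
      exact this.ne
    rw [sum_ite_mem_sym2 _ huv, Sym2.lift_mk]
    by_cases hlu : l = u
    · subst hlu
      have := one_div_sqrt_one_add_le (hpos v)
      simpa [hl] using this
    by_cases hlv : l = v
    · subst hlv
      have := one_div_sqrt_one_add_le (hpos u)
      dsimp only
      rw [add_comm (degR G u : ℝ), add_comm (1 / (degR G u : ℝ))]
      simpa [hl] using this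
    · have := one_div_sqrt_le_affine (hpos u) (hpos v)
      simpa [hlu, hlv] using this
  rw [Finset.sum_sub_distrib, Finset.sum_add_distrib, ← Finset.mul_sum, ← Finset.mul_sum,
    sum_edges_endpoints, sum_edges_ite_mem, hl, Finset.sum_const, card_edges_toFinset,
    hedges] at hle
  have h1 : ∑ v, (degR G v : ℝ) * (1 / (degR G v : ℝ)) = n := by
    rw [← hcard, Finset.sum_congr rfl (g := fun _ ↦ (1 : ℝ))]
    · simp
    · intro v _
      have := hpos v
      field_simp
  rw [h1, nsmul_eq_mul] at hle
  push_cast at hle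
  have h5 : √5 < 2.24 := (Real.sqrt_lt' (by norm_num)).2 (by norm_num)
  have h6 : 6 / 2.24 < 6 / √5 := by gcongr
  norm_num at h6
  linarith

/-- In a bicyclic graph without pendant vertices and with two vertices of degree at least three,
those two have degree three and all others have degree two. -/
lemma degR_eq_of_two_le [DecidableEq V] {n : ℕ} (hcard : Fintype.card V = n)
    (hedges : G.edgeSet.ncard = n + 1) (h2 : ∀ v, 2 ≤ degR G v) {x y : V} (hxy : x ≠ y)
    (hx : 3 ≤ degR G x) (hy : 3 ≤ degR G y) (v : V) :
    degR G v = 2 + (if v = x then 1 else 0) + (if v = y then 1 else 0) := by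
  have hle : ∀ v ∈ Finset.univ,
      2 + (if v = x then 1 else 0) + (if v = y then 1 else 0) ≤ degR G v := by
    intro v _
    have := h2 v
    split_ifs with h h' h' <;> subst_vars <;> first | omega | exact absurd rfl hxy
  refine ((Finset.sum_eq_sum_iff_of_le hle).1 ?_ v (Finset.mem_univ v)).symm
  rw [sum_degR, hedges, Finset.sum_add_distrib, Finset.sum_add_distrib]
  simp [hcard]
  ring

lemma sumConn_eq_of_two_le {n : ℕ} (hcard : Fintype.card V = n)
    (hedges : G.edgeSet.ncard = n + 1) (h2 : ∀ v, 2 ≤ degR G v) {x y : V} (hxy : x ≠ y)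
    (hx : 3 ≤ degR G x) (hy : 3 ≤ degR G y) [Decidable (G.Adj x y)] :
    sumConn G = if G.Adj x y then ((n : ℝ) - 4) / 2 + 1 / √6 + 4 / √5
      else ((n : ℝ) - 5) / 2 + 6 / √5 := by
  classical
  have hd := degR_eq_of_two_le hcard hedges h2 hxy hx hy
  have hs4 : √4 = 2 := by
    rw [show (4 : ℝ) = 2 ^ 2 by norm_num]; exact Real.sqrt_sq (by norm_num)
  have key : sumConn G = ∑ e ∈ G.edgeSet.toFinite.toFinset,
      (1 / 2 + (1 / √5 - 1 / 2) * (if x ∈ e then 1 else 0) +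
        (1 / √5 - 1 / 2) * (if y ∈ e then 1 else 0) +
        (1 / √6 + 1 / 2 - 2 / √5) * (if e = s(x, y) then 1 else 0)) := by
    refine Finset.sum_congr rfl fun e he ↦ ?_
    induction e with
    | h u v =>
    have huv : u ≠ v := by
      have : G.Adj u v := by simpa using he
      exact this.ne
    rw [Sym2.lift_mk]
    simp only [hd, Sym2.mem_iff, Sym2.eq_iff]
    by_cases hux : u = x <;> by_cases huy : u = y <;> by_cases hvx : v = x <;>
      by_cases hvy : v = y <;> subst_vars <;> simp_all [eq_comm] <;> norm_num [hs4] <;>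
      ring_nf
  rw [key, Finset.sum_add_distrib, Finset.sum_add_distrib, Finset.sum_add_distrib,
    ← Finset.mul_sum, ← Finset.mul_sum, ← Finset.mul_sum, sum_edges_ite_mem, sum_edges_ite_mem,
    Finset.sum_const, card_edges_toFinset, hedges, Finset.sum_ite_eq', hd, hd]
  simp only [if_neg hxy, if_neg hxy.symm, Set.Finite.mem_toFinset, SimpleGraph.mem_edgeSet]
  split_ifs <;> simp <;> ring

end Counting

/-! ### Embedding dumbbells -/

lemma three_le_ncard_of_mem {α : Type*} [Finite α] {s : Set α} {x y z : α} (hx : x ∈ s)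
    (hy : y ∈ s) (hz : z ∈ s) (hxy : x ≠ y) (hxz : x ≠ z) (hyz : y ≠ z) : 3 ≤ s.ncard := by
  rw [← Set.ncard_eq_three.2 ⟨x, y, z, hxy, hxz, hyz, rfl⟩]
  refine Set.ncard_le_ncard ?_ (Set.toFinite s)
  rintro w (rfl | rfl | rfl) <;> assumption

lemma two_le_ncard_of_mem {α : Type*} [Finite α] {s : Set α} {x y : α} (hx : x ∈ s)
    (hy : y ∈ s) (hxy : x ≠ y) : 2 ≤ s.ncard := by
  rw [← Set.ncard_pair hxy]
  refine Set.ncard_le_ncard ?_ (Set.toFinite s)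
  rintro w (rfl | rfl) <;> assumption

section Embedding

variable {W : Type*} {H : SimpleGraph W}

lemma image_neighborSet_subset (f : H →g G) (w : W) :
    f '' H.neighborSet w ⊆ G.neighborSet (f w) := by
  rintro _ ⟨w', hw', rfl⟩
  exact f.map_adj hw'

lemma degR_le_of_injective [Finite V] (f : H →g G) (hf : Function.Injective f) (w : W) :
    degR H w ≤ degR G (f w) := by
  rw [degR, degR, ← Set.ncard_image_of_injective _ hf]
  exact Set.ncard_le_ncard (image_neighborSet_subset f w) (Set.toFinite _)

/-- An injective homomorphism into a connected graph that does not increase degrees is an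
isomorphism. -/
lemma nonempty_iso_of_degR_le [Finite V] [Nonempty W] (hconn : G.Connected) (f : H →g G)
    (hf : Function.Injective f) (hdeg : ∀ w, degR G (f w) ≤ degR H w) : Nonempty (G ≃g H) := by
  have himage : ∀ w, f '' H.neighborSet w = G.neighborSet (f w) := fun w ↦
    Set.eq_of_subset_of_ncard_le (image_neighborSet_subset f w)
      (by rw [Set.ncard_image_of_injective _ hf]; exact hdeg w) (Set.toFinite _)
  have hsurj : Function.Surjective f := by
    obtain ⟨w₀⟩ := ‹Nonempty W›
    intro v
    obtain ⟨p⟩ := hconn.preconnected v (f w₀)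
    generalize hz : f w₀ = z at p
    induction p with
    | nil => exact ⟨w₀, hz⟩
    | cons h _ ih =>
      obtain ⟨w, rfl⟩ := ih hz
      have : _ ∈ f '' H.neighborSet w := (himage w).ge h.symm
      obtain ⟨w', -, hw'⟩ := this
      exact ⟨w', hw'⟩
  refine ⟨(RelIso.symm ⟨Equiv.ofBijective f ⟨hf, hsurj⟩, fun {a b} ↦ ⟨fun h ↦ ?_, f.map_adj⟩⟩)⟩
  have : f b ∈ f '' H.neighborSet a := (himage a).ge h
  obtain ⟨b', hb', h'⟩ := this
  exact hf h' ▸ hb'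

/-- A bicyclic graph without pendant vertices is determined by a subgraph of minimum degree two
with two vertices of degree three. -/
lemma nonempty_iso_of_bicyclic [Fintype V] {n : ℕ} (hcard : Fintype.card V = n)
    (hconn : G.Connected) (hedges : G.edgeSet.ncard = n + 1) (h2 : ∀ v, 2 ≤ degR G v)
    (f : H →g G) (hf : Function.Injective f) (hH : ∀ w, 2 ≤ degR H w) {x y : W} (hxy : x ≠ y)
    (hx : 3 ≤ degR H x) (hy : 3 ≤ degR H y) : Nonempty (G ≃g H) := by
  classical
  have : Nonempty W := ⟨x⟩
  refine nonempty_iso_of_degR_le hconn f hf fun w ↦ ?_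
  rw [degR_eq_of_two_le hcard hedges h2 (hf.ne hxy) (hx.trans (degR_le_of_injective f hf x))
    (hy.trans (degR_le_of_injective f hf y)), hf.eq_iff, hf.eq_iff]
  have := hH w
  split_ifs <;> subst_vars <;> first | omega | exact absurd rfl hxy

lemma degR_iso [Finite V] [Finite W] (f : G ≃g H) (v : V) : degR G v = degR H (f v) :=
  le_antisymm (degR_le_of_injective f.toHom f.injective v)
    (by simpa using degR_le_of_injective f.symm.toHom f.symm.injective (f v))

end Embedding

/-! ### Degrees in the dumbbell graphs -/

lemma exists_cycleGraph_adj {a : ℕ} (ha : 3 ≤ a) (i : Fin a) :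
    ∃ j k, j ≠ k ∧ (cycleGraph a).Adj i j ∧ (cycleGraph a).Adj i k := by
  obtain ⟨m, rfl⟩ := Nat.exists_eq_add_of_le' ha
  obtain ⟨j, k, hjk, h⟩ := Finset.card_eq_two.1 (cycleGraph_degree_three_le (v := i))
  refine ⟨j, k, hjk, ?_, ?_⟩ <;> rw [← mem_neighborFinset, h] <;> simp

lemma twoCyclesEdge_adj_inl {a b : ℕ} {i j : Fin a} (h : (cycleGraph a).Adj i j) :
    (twoCyclesEdge a b).Adj (.inl i) (.inl j) :=
  ⟨by simpa using h.ne, .inl (.inl ⟨i, j, rfl, rfl, h⟩)⟩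

lemma twoCyclesEdge_adj_inr {a b : ℕ} {i j : Fin b} (h : (cycleGraph b).Adj i j) :
    (twoCyclesEdge a b).Adj (.inr i) (.inr j) :=
  ⟨by simpa using h.ne, .inl (.inr (.inl ⟨i, j, rfl, rfl, h⟩))⟩

lemma twoCyclesEdge_adj_joints {a b : ℕ} (ha : 0 < a) (hb : 0 < b) :
    (twoCyclesEdge a b).Adj (.inl ⟨0, ha⟩) (.inr ⟨0, hb⟩) :=
  ⟨by simp, .inl (.inr (.inr ⟨ha, hb, rfl, rfl⟩))⟩

lemma two_le_degR_twoCyclesEdge {a b : ℕ} (ha : 3 ≤ a) (hb : 3 ≤ b) (v : Fin a ⊕ Fin b) :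
    2 ≤ degR (twoCyclesEdge a b) v := by
  rcases v with i | i
  · obtain ⟨j, k, hjk, hj, hk⟩ := exists_cycleGraph_adj ha i
    exact two_le_ncard_of_mem (twoCyclesEdge_adj_inl hj) (twoCyclesEdge_adj_inl hk) (by simpa)
  · obtain ⟨j, k, hjk, hj, hk⟩ := exists_cycleGraph_adj hb i
    exact two_le_ncard_of_mem (twoCyclesEdge_adj_inr hj) (twoCyclesEdge_adj_inr hk) (by simpa)

lemma three_le_degR_twoCyclesEdge_inl {a b : ℕ} (ha : 3 ≤ a) (hb : 3 ≤ b) :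
    3 ≤ degR (twoCyclesEdge a b) (.inl ⟨0, by omega⟩) := by
  obtain ⟨j, k, hjk, hj, hk⟩ := exists_cycleGraph_adj ha ⟨0, by omega⟩
  exact three_le_ncard_of_mem (twoCyclesEdge_adj_inl hj) (twoCyclesEdge_adj_inl hk)
    (twoCyclesEdge_adj_joints (by omega) (by omega : 0 < b)) (by simpa) (by simp) (by simp)

lemma three_le_degR_twoCyclesEdge_inr {a b : ℕ} (ha : 3 ≤ a) (hb : 3 ≤ b) :
    3 ≤ degR (twoCyclesEdge a b) (.inr ⟨0, by omega⟩) := by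
  obtain ⟨j, k, hjk, hj, hk⟩ := exists_cycleGraph_adj hb ⟨0, by omega⟩
  exact three_le_ncard_of_mem (twoCyclesEdge_adj_inr hj) (twoCyclesEdge_adj_inr hk)
    (twoCyclesEdge_adj_joints (by omega : 0 < a) (by omega)).symm (by simpa) (by simp) (by simp)

lemma twoCyclesPath_adj_inl {a b k : ℕ} {i j : Fin a} (h : (cycleGraph a).Adj i j) :
    (twoCyclesPath a b k).Adj (.inl (.inl i)) (.inl (.inl j)) :=
  ⟨by simpa using h.ne, .inl (.inl ⟨i, j, rfl, rfl, h⟩)⟩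

lemma twoCyclesPath_adj_inr {a b k : ℕ} {i j : Fin b} (h : (cycleGraph b).Adj i j) :
    (twoCyclesPath a b k).Adj (.inl (.inr i)) (.inl (.inr j)) :=
  ⟨by simpa using h.ne, .inl (.inr (.inl ⟨i, j, rfl, rfl, h⟩))⟩

lemma twoCyclesPath_adj_first {a b k : ℕ} (ha : 0 < a) (hk : 0 < k) :
    (twoCyclesPath a b k).Adj (.inl (.inl ⟨0, ha⟩)) (.inr ⟨0, hk⟩) :=
  ⟨by simp, .inl (.inr (.inr (.inl ⟨ha, hk, rfl, rfl⟩)))⟩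

lemma twoCyclesPath_adj_last {a b k : ℕ} (hb : 0 < b) {i : Fin k} (hi : (i : ℕ) + 1 = k) :
    (twoCyclesPath a b k).Adj (.inr i) (.inl (.inr ⟨0, hb⟩)) :=
  ⟨by simp, .inl (.inr (.inr (.inr (.inr
    ⟨hb, i.pos, by simp only [Sum.inr.injEq, Fin.ext_iff]; omega, rfl⟩))))⟩

lemma twoCyclesPath_adj_succ {a b k : ℕ} {i j : Fin k} (h : (j : ℕ) = i + 1) :
    (twoCyclesPath a b k).Adj (.inr i) (.inr j) :=
  ⟨by simp only [ne_eq, Sum.inr.injEq, Fin.ext_iff]; omega,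
    .inl (.inr (.inr (.inr (.inl ⟨i, j, rfl, rfl, h⟩))))⟩

lemma two_le_degR_twoCyclesPath {a b k : ℕ} (ha : 3 ≤ a) (hb : 3 ≤ b)
    (v : (Fin a ⊕ Fin b) ⊕ Fin k) : 2 ≤ degR (twoCyclesPath a b k) v := by
  rcases v with (i | i) | i
  · obtain ⟨j, k, hjk, hj, hk⟩ := exists_cycleGraph_adj ha i
    exact two_le_ncard_of_mem (twoCyclesPath_adj_inl hj) (twoCyclesPath_adj_inl hk) (by simpa)
  · obtain ⟨j, k, hjk, hj, hk⟩ := exists_cycleGraph_adj hb i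
    exact two_le_ncard_of_mem (twoCyclesPath_adj_inr hj) (twoCyclesPath_adj_inr hk) (by simpa)
  · obtain ⟨x, hx, hx'⟩ : ∃ x, (twoCyclesPath a b k).Adj (.inr i) x ∧
        (x = .inl (.inl ⟨0, by omega⟩) ∨ ∃ j : Fin k, x = .inr j ∧ j < i) := by
      obtain ⟨i, hi⟩ := i
      rcases i with - | i
      · exact ⟨_, (twoCyclesPath_adj_first (by omega) hi).symm, .inl rfl⟩
      · exact ⟨.inr ⟨i, by omega⟩, (twoCyclesPath_adj_succ rfl).symm,
          .inr ⟨_, rfl, by simp [Fin.lt_def]⟩⟩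
    obtain ⟨y, hy, hy'⟩ : ∃ y, (twoCyclesPath a b k).Adj (.inr i) y ∧
        (y = .inl (.inr ⟨0, by omega⟩) ∨ ∃ j : Fin k, y = .inr j ∧ i < j) := by
      by_cases hi : (i : ℕ) + 1 = k
      · exact ⟨_, twoCyclesPath_adj_last (by omega) hi, .inl rfl⟩
      · exact ⟨.inr ⟨i + 1, by omega⟩, twoCyclesPath_adj_succ rfl,
          .inr ⟨_, rfl, by simp [Fin.lt_def]⟩⟩
    refine two_le_ncard_of_mem hx hy ?_
    rcases hx' with rfl | ⟨j, rfl, hj⟩ <;> rcases hy' with rfl | ⟨j', rfl, hj'⟩ <;> simp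
    exact (hj.trans hj').ne

lemma three_le_degR_twoCyclesPath_inl {a b k : ℕ} (ha : 3 ≤ a) (hk : 0 < k) :
    3 ≤ degR (twoCyclesPath a b k) (.inl (.inl ⟨0, by omega⟩)) := by
  obtain ⟨i, j, hij, hi, hj⟩ := exists_cycleGraph_adj ha ⟨0, by omega⟩
  exact three_le_ncard_of_mem (twoCyclesPath_adj_inl hi) (twoCyclesPath_adj_inl hj)
    (twoCyclesPath_adj_first (by omega) hk) (by simpa) (by simp) (by simp)

lemma three_le_degR_twoCyclesPath_inr {a b k : ℕ} (hb : 3 ≤ b) (hk : 0 < k) :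
    3 ≤ degR (twoCyclesPath a b k) (.inl (.inr ⟨0, by omega⟩)) := by
  obtain ⟨i, j, hij, hi, hj⟩ := exists_cycleGraph_adj hb ⟨0, by omega⟩
  exact three_le_ncard_of_mem (twoCyclesPath_adj_inr hi) (twoCyclesPath_adj_inr hj)
    (twoCyclesPath_adj_last (i := ⟨k - 1, by omega⟩) (by omega)
      (show k - 1 + 1 = k by omega)).symm (by simpa) (by simp) (by simp)

lemma not_adj_twoCyclesPath {a b k : ℕ} (i : Fin a) (j : Fin b) :
    ¬ (twoCyclesPath a b k).Adj (.inl (.inl i)) (.inl (.inr j)) := by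
  simp [twoCyclesPath]

/-! ### The values on the dumbbell graphs -/

section Values

variable [Fintype V] {n : ℕ}

lemma IsB1a.sumConn_eq (hcard : Fintype.card V = n) (hedges : G.edgeSet.ncard = n + 1)
    (h : IsB1a n G) : sumConn G = ((n : ℝ) - 4) / 2 + 1 / √6 + 4 / √5 := by
  classical
  obtain ⟨a, b, ha, hb, -, ⟨f⟩⟩ := h
  have hadj := f.symm.map_adj_iff.2 (twoCyclesEdge_adj_joints (by omega : 0 < a) (by omega : 0 < b))
  rw [sumConn_eq_of_two_le hcard hedges
    (fun v ↦ degR_iso f v ▸ two_le_degR_twoCyclesEdge ha hb _) hadj.ne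
    (degR_iso f.symm _ ▸ three_le_degR_twoCyclesEdge_inl ha hb)
    (degR_iso f.symm _ ▸ three_le_degR_twoCyclesEdge_inr ha hb), if_pos hadj]

lemma IsB1b.sumConn_eq (hcard : Fintype.card V = n) (hedges : G.edgeSet.ncard = n + 1)
    (h : IsB1b n G) : sumConn G = ((n : ℝ) - 5) / 2 + 6 / √5 := by
  classical
  obtain ⟨a, b, ha, hb, hab, ⟨f⟩⟩ := h
  have hadj := f.symm.map_adj_iff.not.2
    (not_adj_twoCyclesPath (k := n - a - b) (⟨0, by omega⟩ : Fin a) (⟨0, by omega⟩ : Fin b))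
  rw [sumConn_eq_of_two_le hcard hedges
    (fun v ↦ degR_iso f v ▸ two_le_degR_twoCyclesPath ha hb _) (f.symm.injective.ne (by simp))
    (degR_iso f.symm _ ▸ three_le_degR_twoCyclesPath_inl ha (by omega))
    (degR_iso f.symm _ ▸ three_le_degR_twoCyclesPath_inr hb (by omega)), if_neg hadj]

end Values

/-! ### Finding a dumbbell in a graph with two disjoint cycles -/

lemma exists_hom_cycleGraph {u : V} {c : G.Walk u u} (hc : c.IsCycle) :
    ∃ f : cycleGraph c.length →g G, Function.Injective f ∧ (∀ i, f i ∈ c.support) ∧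
      ∀ h : 0 < c.length, f ⟨0, h⟩ = u := by
  have hstep : ∀ i j : Fin c.length, (i - j).val = 1 → G.Adj (c.getVert i) (c.getVert j) := by
    intro i j h
    rcases le_or_gt j i with hji | hji
    · rw [Fin.sub_val_of_le hji] at h
      rw [show (i : ℕ) = j + 1 by omega]
      exact (c.adj_getVert_succ j.2).symm
    · rw [Fin.coe_sub_iff_lt.2 hji] at h
      have h0 : (i : ℕ) = 0 := by omega
      have hj := c.adj_getVert_succ j.2
      rw [show (j : ℕ) + 1 = c.length by omega, c.getVert_length] at hj
      rw [h0, c.getVert_zero]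
      exact hj.symm
  refine ⟨⟨fun i ↦ c.getVert i, fun {i j} h ↦ ?_⟩, fun i j h ↦ ?_,
    fun i ↦ c.getVert_mem_support i, fun _ ↦ c.getVert_zero⟩
  · rcases cycleGraph_adj'.1 h with h | h
    · exact hstep i j h
    · exact (hstep j i h).symm
  · exact Fin.ext (hc.getVert_injOn' (Nat.le_sub_one_of_lt i.2) (Nat.le_sub_one_of_lt j.2) h)

/-- A shortest path between two sets of vertices meets them only in its end points. -/
lemma exists_path_between (hconn : G.Connected) {s t : Set V} (hs : s.Nonempty)
    (ht : t.Nonempty) : ∃ u ∈ s, ∃ v ∈ t, ∃ p : G.Walk u v, p.IsPath ∧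
      ∀ i, 0 < i → i < p.length → p.getVert i ∉ s ∧ p.getVert i ∉ t := by
  classical
  have hex : ∃ d, ∃ u ∈ s, ∃ v ∈ t, ∃ p : G.Walk u v, p.length = d := by
    obtain ⟨u, hu⟩ := hs
    obtain ⟨v, hv⟩ := ht
    obtain ⟨p⟩ := hconn.preconnected u v
    exact ⟨_, u, hu, v, hv, p, rfl⟩
  obtain ⟨u, hu, v, hv, p, hp⟩ := Nat.find_spec hex
  have hmin : ∀ {u' v' : V} (q : G.Walk u' v'), u' ∈ s → v' ∈ t → p.length ≤ q.length :=
    fun q hu' hv' ↦ hp ▸ Nat.find_min' hex ⟨_, hu', _, hv', q, rfl⟩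
  refine ⟨u, hu, v, hv, p, p.isPath_of_length_eq_dist ?_, fun i hi hip ↦ ⟨fun h ↦ ?_, fun h ↦ ?_⟩⟩
  · obtain ⟨q, hq⟩ := hconn.exists_walk_length_eq_dist u v
    exact le_antisymm (hq ▸ hmin q hu hv) (dist_le p)
  · have := hmin (p.drop i) h hv
    rw [Walk.drop_length] at this
    omega
  · have := hmin (p.take i) hu h
    rw [Walk.take_length] at this
    omega

lemma isB1a_or_isB1b [Fintype V] {n : ℕ} (hcard : Fintype.card V = n) (hconn : G.Connected)
    (hedges : G.edgeSet.ncard = n + 1) (h2 : ∀ v, 2 ≤ degR G v)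
    {u₀ v₀ : V} {c₁' : G.Walk u₀ u₀} {c₂' : G.Walk v₀ v₀} (hc₁' : c₁'.IsCycle)
    (hc₂' : c₂'.IsCycle) (hdisj' : List.Disjoint c₁'.support c₂'.support) :
    IsB1a n G ∨ IsB1b n G := by
  classical
  obtain ⟨u, hu, v, hv, p, hp, hint⟩ := exists_path_between hconn
    (s := {w | w ∈ c₁'.support}) (t := {w | w ∈ c₂'.support})
    ⟨u₀, c₁'.start_mem_support⟩ ⟨v₀, c₂'.start_mem_support⟩
  have hlen₁ := hc₁'.three_le_length
  have hlen₂ := hc₂'.three_le_length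
  obtain ⟨f₁, hf₁, hs₁, h0₁⟩ := exists_hom_cycleGraph ((Walk.isCycle_rotate hu).2 hc₁')
  obtain ⟨f₂, hf₂, hs₂, h0₂⟩ := exists_hom_cycleGraph ((Walk.isCycle_rotate hv).2 hc₂')
  simp only [Walk.mem_support_rotate_iff] at hs₁ hs₂
  rw [← Walk.length_rotate c₁' u hu] at hlen₁
  rw [← Walk.length_rotate c₂' v hv] at hlen₂
  generalize (c₁'.rotate u hu).length = a at *
  generalize (c₂'.rotate v hv).length = b at *
  have hne : ∀ i j, f₁ i ≠ f₂ j := fun i j h ↦ hdisj' (hs₁ i) (h ▸ hs₂ j)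
  have hpos : p.length ≠ 0 := fun h ↦ hdisj' hu (Walk.eq_of_length_eq_zero h ▸ hv)
  by_cases h1 : p.length = 1
  · left
    have huv : G.Adj u v := Walk.adj_of_length_eq_one h1
    let F : twoCyclesEdge a b →g G := ⟨Sum.elim f₁ f₂, by
      have key : ∀ x y, ((∃ i j, x = Sum.inl i ∧ y = Sum.inl j ∧ (cycleGraph a).Adj i j) ∨
          (∃ i j, x = Sum.inr i ∧ y = Sum.inr j ∧ (cycleGraph b).Adj i j) ∨
          (∃ (ha : 0 < a) (hb : 0 < b), x = Sum.inl ⟨0, ha⟩ ∧ y = Sum.inr ⟨0, hb⟩)) →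
          G.Adj (Sum.elim f₁ f₂ x) (Sum.elim f₁ f₂ y) := by
        rintro x y (⟨i, j, rfl, rfl, h⟩ | ⟨i, j, rfl, rfl, h⟩ | ⟨ha, hb, rfl, rfl⟩)
        · exact f₁.map_adj h
        · exact f₂.map_adj h
        · simpa [h0₁, h0₂] using huv
      rintro x y ⟨-, h | h⟩
      · exact key x y h
      · exact (key y x h).symm⟩
    have hF : Function.Injective F := hf₁.sumElim hf₂ hne
    obtain ⟨e⟩ := nonempty_iso_of_bicyclic hcard hconn hedges h2 F hF
      (two_le_degR_twoCyclesEdge hlen₁ hlen₂) (by simp)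
      (three_le_degR_twoCyclesEdge_inl hlen₁ hlen₂) (three_le_degR_twoCyclesEdge_inr hlen₁ hlen₂)
    refine ⟨a, b, hlen₁, hlen₂, ?_, ⟨e⟩⟩
    simpa [hcard] using (Fintype.card_congr e.toEquiv).symm
  · right
    obtain ⟨k, hk⟩ : ∃ k, p.length = k + 2 := ⟨p.length - 2, by omega⟩
    let g : Fin (k + 1) → V := fun i ↦ p.getVert (i + 1)
    have hg : Function.Injective g := fun i j h ↦ by
      have := hp.getVert_injOn (Set.mem_ofPred.2 (by omega : (i : ℕ) + 1 ≤ p.length))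
        (Set.mem_ofPred.2 (by omega : (j : ℕ) + 1 ≤ p.length)) h
      exact Fin.ext (by omega)
    let F : twoCyclesPath a b (k + 1) →g G := ⟨Sum.elim (Sum.elim f₁ f₂) g, by
      have key : ∀ x y, ((∃ i j, x = Sum.inl (Sum.inl i) ∧ y = Sum.inl (Sum.inl j) ∧
            (cycleGraph a).Adj i j) ∨
          (∃ i j, x = Sum.inl (Sum.inr i) ∧ y = Sum.inl (Sum.inr j) ∧
            (cycleGraph b).Adj i j) ∨
          (∃ (ha : 0 < a) (hk : 0 < k + 1), x = Sum.inl (Sum.inl ⟨0, ha⟩) ∧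
            y = Sum.inr ⟨0, hk⟩) ∨
          (∃ i j : Fin (k + 1), x = Sum.inr i ∧ y = Sum.inr j ∧ (j : ℕ) = (i : ℕ) + 1) ∨
          (∃ (hb : 0 < b) (hk : 0 < k + 1),
            x = Sum.inr ⟨k + 1 - 1, Nat.sub_lt hk Nat.one_pos⟩ ∧
            y = Sum.inl (Sum.inr ⟨0, hb⟩))) →
          G.Adj (Sum.elim (Sum.elim f₁ f₂) g x) (Sum.elim (Sum.elim f₁ f₂) g y) := by
        rintro x y (⟨i, j, rfl, rfl, h⟩ | ⟨i, j, rfl, rfl, h⟩ | ⟨ha, hk', rfl, rfl⟩ |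
          ⟨i, j, rfl, rfl, h⟩ | ⟨hb, hk', rfl, rfl⟩)
        · exact f₁.map_adj h
        · exact f₂.map_adj h
        · simpa [h0₁, g] using p.adj_getVert_succ (i := 0) (by omega)
        · simpa [g, h] using p.adj_getVert_succ (i := i + 1) (by omega)
        · have := p.adj_getVert_succ (i := k + 1) (by omega)
          rw [← hk, p.getVert_length] at this
          simpa [h0₂, g] using this
      rintro x y ⟨-, h | h⟩
      · exact key x y h
      · exact (key y x h).symm⟩
    have hF : Function.Injective F := by
      refine (hf₁.sumElim hf₂ hne).sumElim hg ?_
      rintro (i | i) j h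
      · exact (hint (j + 1) (by omega) (by omega)).1 (show g j ∈ _ from h ▸ hs₁ i)
      · exact (hint (j + 1) (by omega) (by omega)).2 (show g j ∈ _ from h ▸ hs₂ i)
    obtain ⟨e⟩ := nonempty_iso_of_bicyclic hcard hconn hedges h2 F hF
      (two_le_degR_twoCyclesPath hlen₁ hlen₂) (by simp)
      (three_le_degR_twoCyclesPath_inl hlen₁ k.succ_pos)
      (three_le_degR_twoCyclesPath_inr hlen₂ k.succ_pos)
    have hn : a + b + (k + 1) = n := by
      simpa [hcard] using (Fintype.card_congr e.toEquiv).symm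
    refine ⟨a, b, hlen₁, hlen₂, by omega, ?_⟩
    rw [show n - a - b = k + 1 by omega]
    exact ⟨e⟩

end SumConn

/-- Let `n ≥ 7` and let `G` be a connected graph on `n` vertices with exactly two
cycles, these cycles being vertex-disjoint (so `G` is bicyclic, with `n + 1` edges,
and contains two vertex-disjoint cycles, i.e. `G ∈ 𝔹₁(n)`). Then
`χ(G) ≤ (n−4)/2 + 1/√6 + 4/√5`, with equality iff `G` is obtained by joining two
vertex-disjoint cycles `C_a`, `C_b` with `a + b = n` by an edge; moreover, if `G` is
not of that form, then `χ(G) ≤ (n−5)/2 + 6/√5`, with equality iff `G` is obtained by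
joining two vertex-disjoint cycles `C_a`, `C_b` with `a + b < n` by a path of length
`n − a − b + 1`. -/
theorem stmt_16 {V : Type*} [Fintype V] (G : SimpleGraph V) (n : ℕ) (hn : 7 ≤ n)
    (hcard : Fintype.card V = n) (hconn : G.Connected)
    (hedges : G.edgeSet.ncard = n + 1)
    (hdisj : ∃ (u v : V) (c₁ : G.Walk u u) (c₂ : G.Walk v v),
      c₁.IsCycle ∧ c₂.IsCycle ∧ List.Disjoint c₁.support c₂.support) :
    (sumConn G ≤ ((n : ℝ) - 4) / 2 + 1 / Real.sqrt 6 + 4 / Real.sqrt 5 ∧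
      (sumConn G = ((n : ℝ) - 4) / 2 + 1 / Real.sqrt 6 + 4 / Real.sqrt 5 ↔
        IsB1a n G)) ∧
    (¬ IsB1a n G →
      sumConn G ≤ ((n : ℝ) - 5) / 2 + 6 / Real.sqrt 5 ∧
      (sumConn G = ((n : ℝ) - 5) / 2 + 6 / Real.sqrt 5 ↔ IsB1b n G)) := by

  have hpos : ∀ v, 1 ≤ degR G v := by
    classical
    have : Nontrivial V := Fintype.one_lt_card_iff_nontrivial.1 (by omega)
    intro v
    have := hconn.preconnected.degree_pos_of_nontrivial v
    rwa [← G.card_neighborSet_eq_degree, ← Nat.card_eq_fintype_card] at this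
  have hlt : ((n : ℝ) - 5) / 2 + 6 / √5 < ((n : ℝ) - 4) / 2 + 1 / √6 + 4 / √5 := by
    have h5 : 2.23 < √5 := Real.lt_sqrt_of_sq_lt (by norm_num)
    have h6 : √6 < 2.45 := (Real.sqrt_lt' (by norm_num)).2 (by norm_num)
    have h5' : 2 / √5 < 2 / 2.23 := by gcongr
    have h6' : 1 / 2.45 < 1 / √6 := by gcongr
    norm_num at h5' h6'
    have : 6 / √5 = 2 / √5 + 4 / √5 := by ring
    rw [one_div (√6)]
    linarith
  have hA := SumConn.IsB1a.sumConn_eq (G := G) hcard hedges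
  have hB := SumConn.IsB1b.sumConn_eq (G := G) hcard hedges
  have htri : sumConn G < ((n : ℝ) - 5) / 2 + 6 / √5 ∨ IsB1a n G ∨ IsB1b n G := by
    by_cases h : ∃ l, degR G l = 1
    · obtain ⟨l, hl⟩ := h
      exact .inl (SumConn.sumConn_lt_of_degR_eq_one hcard hedges hpos hl)
    · push Not at h
      obtain ⟨u, v, c₁, c₂, hc₁, hc₂, hdisj⟩ := hdisj
      exact .inr (SumConn.isB1a_or_isB1b hcard hconn hedges
        (fun v ↦ by have := hpos v; have := h v; omega) hc₁ hc₂ hdisj)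
  refine ⟨⟨?_, fun h ↦ ?_, hA⟩, fun hnA ↦ ⟨?_, fun h ↦ ?_, hB⟩⟩
  · rcases htri with h | h | h
    · linarith
    · exact (hA h).le
    · linarith [hB h]
  · rcases htri with h' | h' | h'
    · linarith
    · exact h'
    · linarith [hB h']
  · rcases htri with h | h | h
    · exact h.le
    · exact absurd h hnA
    · exact (hB h).le
  · rcases htri with h' | h' | h'
    · linarith
    · exact absurd h' hnA
    · exact h'
end
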